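/- The conditional information inequality problem is undecidable: there is no algorithm that, given k ∈ ℤ>0 and vectors a, b ∈ ℚ^{2^k−1}, decides whether the implication aᵀ h(X_1,…,X_k) ≥ 0 → bᵀ h(X_1,…,X_k) ≥ 0 holds for all jointly-distributed random variables X_1,…,X_k with finite support. The problem remains undecidable if either one or both of the two inequalities '≥ 0' are replaced by '= 0'. -/

import Mathlib

open scoped Classical

noncomputable section

/-- The probability of the event `S` under the probability mass function `p`. -/
def Pr {Ω : Type} (p : Ω → ℝ) (S : Set Ω) : ℝ := ∑' ω : S, p ω

/-- `p` is a probability mass function on the sample space `Ω`. -/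
def IsProb {Ω : Type} (p : Ω → ℝ) : Prop := (∀ ω, 0 ≤ p ω) ∧ Pr p Set.univ = 1

/-- The support of a random variable `X`: the set of values attained with positive
probability. -/
def supp {Ω α : Type} (p : Ω → ℝ) (X : Ω → α) : Set α := {a | 0 < Pr p {ω | X ω = a}}

/-- `X` is almost surely a function of `Y` (written `X ≤ι Y` in the paper). -/
def FuncOf {Ω α β : Type} (p : Ω → ℝ) (X : Ω → α) (Y : Ω → β) : Prop :=
  ∃ f : β → α, Pr p {ω | X ω = f (Y ω)} = 1

/-- The random variables `X` and `Y` are independent. -/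
def IndepRV {Ω α β : Type} (p : Ω → ℝ) (X : Ω → α) (Y : Ω → β) : Prop :=
  ∀ (a : α) (b : β), Pr p {ω | X ω = a ∧ Y ω = b} = Pr p {ω | X ω = a} * Pr p {ω | Y ω = b}

/-- The random variables `X`, `Y`, `Z` are mutually independent:
`X ⟂ Y` and `(X, Y) ⟂ Z`. -/
def Indep3 {Ω α β γ : Type} (p : Ω → ℝ) (X : Ω → α) (Y : Ω → β) (Z : Ω → γ) : Prop :=
  IndepRV p X Y ∧ IndepRV p (fun ω => (X ω, Y ω)) Z

/-- The predicate `tri(X, Y, Z)`: each variable is a.s. a function of the other two, and the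
three variables are pairwise independent. -/
def tri {Ω α β γ : Type} (p : Ω → ℝ) (X : Ω → α) (Y : Ω → β) (Z : Ω → γ) : Prop :=
  FuncOf p X (fun ω => (Y ω, Z ω)) ∧ FuncOf p Y (fun ω => (X ω, Z ω)) ∧
    FuncOf p Z (fun ω => (X ω, Y ω)) ∧
    IndepRV p X Y ∧ IndepRV p X Z ∧ IndepRV p Y Z


/-- The Shannon entropy of a random variable `X` with finite support (in nats):
`H(X) = −∑_v P(X = v) log P(X = v)`. -/
def entropy {Ω V : Type} (p : Ω → ℝ) (X : Ω → V) : ℝ :=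
  ∑' v : V, Real.negMulLog (Pr p {ω | X ω = v})

/-- The joint entropy `H(X_S)` of the joint random variable `{X_i}_{i ∈ S}`. -/
def jointEntropy {Ω : Type} (p : Ω → ℝ) {V : ℕ → Type} (X : ∀ i, Ω → V i)
    (S : Finset ℕ) : ℝ :=
  entropy p (fun ω => fun i : {x // x ∈ S} => X i.1 ω)

/-- The `j`-th nonempty subset of `{1, …, k}` (for `0 ≤ j < 2^k − 1`), in the binary
enumeration: `i ∈ S_j ↔ testBit (j+1) (i−1)`.  This indexes the entries of the entropic
vector `h ∈ ℝ^{2^k−1}` by nonempty subsets of `{1,…,k}`. -/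
def subsetOfIdx (k j : ℕ) : Finset ℕ :=
  ((Finset.range k).filter fun i => (j + 1).testBit i).image (· + 1)

/-- The linear combination `aᵀ h(X_1, …, X_k)` of the entropic vector of `X_1, …, X_k`,
where the rational vector `a ∈ ℚ^{2^k−1}` is given as a list of its coordinates. -/
def entCombo {Ω : Type} (p : Ω → ℝ) {V : ℕ → Type} (X : ∀ i, Ω → V i)
    (k : ℕ) (a : List ℚ) : ℝ :=
  ∑ j ∈ Finset.range (2 ^ k - 1), (a.getD j 0 : ℝ) * jointEntropy p X (subsetOfIdx k j)

/-- `RelSign true x` is `x ≥ 0`; `RelSign false x` is `x = 0`. -/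
def RelSign (b : Bool) (x : ℝ) : Prop := if b then 0 ≤ x else x = 0

/-- An instance of the conditional information inequality problem: `(k, a, b)` where `k`
is the number of random variables and `a, b ∈ ℚ^{2^k−1}` are coefficient vectors (as
lists) indexed by the nonempty subsets of `{1,…,k}`. -/
abbrev EntInstance : Type := ℕ × List ℚ × List ℚ

/-- The instance is valid: `k ≥ 1` and the coefficient lists have length `2^k − 1`. -/
def EntValid : EntInstance → Prop := fun inst =>
  match inst with
  | (k, a, b) => 1 ≤ k ∧ a.length = 2 ^ k - 1 ∧ b.length = 2 ^ k - 1

/-- The implication `aᵀ h(X_1,…,X_k) R₁ 0 → bᵀ h(X_1,…,X_k) R₂ 0` holds for all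
jointly-distributed random variables `X_1, …, X_k` with finite support, where `Rᵢ` is `≥`
if `bᵢ = true` and `=` if `bᵢ = false`. -/
def EntHolds (b₁ b₂ : Bool) : EntInstance → Prop := fun inst =>
  match inst with
  | (k, a, b) =>
    ∀ (Ω : Type) (p : Ω → ℝ), IsProb p →
      ∀ (V : ℕ → Type) (X : ∀ i, Ω → V i), (∀ i, (supp p (X i)).Finite) →
        RelSign b₁ (entCombo p X k a) → RelSign b₂ (entCombo p X k b)


open scoped Classical
noncomputable section

namespace UndecCII

section finite
variable {Ω : Type} [Fintype Ω] (p : Ω → ℝ)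

/-- Probability of the fibre of `f` through `ω`. -/
def fib {β : Type} (f : Ω → β) (ω : Ω) : ℝ := ∑ ω', if f ω' = f ω then p ω' else 0

/-- Entropy on a finite space. -/
def ent {β : Type} (f : Ω → β) : ℝ := -∑ ω, p ω * Real.log (fib p f ω)

theorem Pr_eq_tsum {Ω : Type} (p : Ω → ℝ) (S : Set Ω) : Pr p S = ∑' ω, S.indicator p ω :=
  tsum_subtype S p

theorem isProb_summable {Ω : Type} {p : Ω → ℝ} (hp : IsProb p) : Summable p := by
  by_contra h
  have h2 := hp.2
  rw [Pr_eq_tsum, Set.indicator_univ, tsum_eq_zero_of_not_summable h] at h2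
  exact zero_ne_one h2

theorem isProb_tsum {Ω : Type} {p : Ω → ℝ} (hp : IsProb p) : ∑' ω, p ω = 1 := by
  have h2 := hp.2
  rwa [Pr_eq_tsum, Set.indicator_univ] at h2

theorem Pr_nonneg {Ω : Type} {p : Ω → ℝ} (hp : IsProb p) (S : Set Ω) : 0 ≤ Pr p S := by
  rw [Pr_eq_tsum]
  exact tsum_nonneg fun ω => Set.indicator_nonneg (fun _ _ => hp.1 _) _

theorem le_Pr {Ω : Type} {p : Ω → ℝ} (hp : IsProb p) (S : Set Ω) (ω : Ω) (h : ω ∈ S) :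
    p ω ≤ Pr p S := by
  rw [Pr_eq_tsum]
  have := ((isProb_summable hp).indicator S).le_tsum ω
    (fun j _ => Set.indicator_nonneg (fun _ _ => hp.1 _) _)
  rwa [Set.indicator_of_mem h] at this

/-- Reduction of entropies to a finite space. -/
theorem entropy_eq_ent {Ω₀ : Type} {p₀ : Ω₀ → ℝ} (hp : IsProb p₀) (U : Ω₀ → Ω) {β : Type}
    (W : Ω₀ → β) (f : Ω → β) (hf : ∀ ω, p₀ ω ≠ 0 → W ω = f (U ω)) :
    entropy p₀ W = ent (fun t => Pr p₀ {ω | U ω = t}) f := by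
  have hPr : ∀ v, Pr p₀ {ω | W ω = v} =
      ∑ t, if f t = v then Pr p₀ {ω | U ω = t} else 0 := by
    intro v
    have h1 : ∀ ω, ({ω | W ω = v} : Set Ω₀).indicator p₀ ω =
        ∑ t, if f t = v then ({ω | U ω = t} : Set Ω₀).indicator p₀ ω else 0 := by
      intro ω
      by_cases h0 : p₀ ω = 0
      · have : ∀ S : Set Ω₀, S.indicator p₀ ω = 0 := by
          intro S; rw [Set.indicator_apply]; split_ifs <;> simp [h0]
        simp [this]
      · simp only [Set.indicator_apply, Set.mem_ofPred_eq, hf ω h0]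
        rw [Finset.sum_eq_single (U ω)]
        · simp
        · intro b _ hb
          simp [hb.symm]
        · simp
    rw [Pr_eq_tsum, tsum_congr h1, Summable.tsum_finsetSum]
    · refine Finset.sum_congr rfl fun t _ => ?_
      split_ifs
      · rw [Pr_eq_tsum]
      · simp
    · intro t _
      split_ifs
      · exact (isProb_summable hp).indicator _
      · exact summable_zero
  unfold entropy ent
  rw [tsum_eq_sum (s := Finset.univ.image f)]
  · rw [← Finset.sum_neg_distrib, ← Finset.sum_fiberwise_of_maps_to (s := Finset.univ)
      (t := Finset.univ.image f) (g := f) (fun t _ => Finset.mem_image_of_mem f (Finset.mem_univ t))]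
    refine Finset.sum_congr rfl fun v _ => ?_
    rw [Real.negMulLog, hPr v]
    have : ∀ t ∈ Finset.univ.filter (fun t => f t = v),
        -(Pr p₀ {ω | U ω = t} * Real.log (fib (fun t => Pr p₀ {ω | U ω = t}) f t)) =
        Pr p₀ {ω | U ω = t} * (-Real.log (∑ t, if f t = v then Pr p₀ {ω | U ω = t} else 0)) := by
      intro t ht
      rw [Finset.mem_filter] at ht
      rw [fib, ht.2]; ring
    rw [Finset.sum_congr rfl this, ← Finset.sum_mul, Finset.sum_filter]
    ring
  · intro v hv
    rw [hPr v, Finset.sum_eq_zero, Real.negMulLog_zero]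
    intro t _
    rw [if_neg]
    rintro rfl
    exact hv (Finset.mem_image_of_mem f (Finset.mem_univ t))

variable {p}

theorem fib_congr {β γ : Type} {f : Ω → β} {h : Ω → γ}
    (hfh : ∀ ω ω', f ω = f ω' ↔ h ω = h ω') : fib p f = fib p h := by
  funext ω
  unfold fib
  refine Finset.sum_congr rfl fun ω' _ => ?_
  simp [hfh ω' ω]

theorem ent_congr {β γ : Type} {f : Ω → β} {h : Ω → γ}
    (hfh : ∀ ω ω', f ω = f ω' ↔ h ω = h ω') : ent p f = ent p h := by
  unfold ent; rw [fib_congr hfh]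

variable (hp : ∀ ω, 0 < p ω)
include hp

theorem fib_pos {β : Type} (f : Ω → β) (ω : Ω) : 0 < fib p f ω := by
  unfold fib
  refine Finset.sum_pos' (fun i _ => ?_) ⟨ω, Finset.mem_univ _, by simp [hp]⟩
  split_ifs
  · exact (hp _).le
  · exact le_rfl

theorem fib_le {β γ : Type} {f : Ω → β} {h : Ω → γ}
    (hfh : ∀ ω ω', h ω = h ω' → f ω = f ω') (ω : Ω) : fib p h ω ≤ fib p f ω := by
  unfold fib
  refine Finset.sum_le_sum fun ω' _ => ?_
  by_cases h1 : h ω' = h ω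
  · simp [h1, hfh _ _ h1]
  · simp only [h1, if_false]
    split_ifs
    · exact (hp _).le
    · exact le_rfl

theorem ent_mono {β γ : Type} {f : Ω → β} {h : Ω → γ}
    (hfh : ∀ ω ω', h ω = h ω' → f ω = f ω') : ent p f ≤ ent p h := by
  unfold ent
  refine neg_le_neg (Finset.sum_le_sum fun ω _ => ?_)
  exact mul_le_mul_of_nonneg_left (Real.log_le_log (fib_pos hp h ω) (fib_le hp hfh ω)) (hp ω).le

theorem func_of_ent_eq {β γ : Type} {f : Ω → β} {h : Ω → γ}
    (hfh : ∀ ω ω', h ω = h ω' → f ω = f ω') (he : ent p f = ent p h) :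
    ∀ ω ω', f ω = f ω' → h ω = h ω' := by
  have h1 : ∑ ω, p ω * Real.log (fib p h ω) = ∑ ω, p ω * Real.log (fib p f ω) := by
    unfold ent at he; linarith
  have h2 := (Finset.sum_eq_sum_iff_of_le (fun ω _ => mul_le_mul_of_nonneg_left
    (Real.log_le_log (fib_pos hp h ω) (fib_le hp hfh ω)) (hp ω).le)).1 h1
  intro ω ω' hf
  by_contra hne
  have h3 := mul_left_cancel₀ (hp ω').ne' (h2 ω' (Finset.mem_univ _))
  have h4 := Real.log_injOn_pos (fib_pos hp h ω') (fib_pos hp f ω') h3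
  unfold fib at h4
  have h5 := (Finset.sum_eq_sum_iff_of_le (fun i _ => ?_)).1 h4 ω (Finset.mem_univ _)
  · simp [hf, hne] at h5
    exact (hp ω).ne' h5.symm
  · by_cases h1 : h i = h ω'
    · simp [h1, hfh _ _ h1]
    · simp only [h1, if_false]
      split_ifs
      · exact (hp _).le
      · exact le_rfl

/-- Auxiliary double sum for independence. -/
theorem sum_ratio {β γ : Type} (f : Ω → β) (h : Ω → γ) :
    ∑ ω, p ω * (fib p f ω * fib p h ω / fib p (fun ω => (f ω, h ω)) ω) =
    ∑ ω₁, ∑ ω₂, p ω₁ * p ω₂ * (if ∃ ω, f ω = f ω₁ ∧ h ω = h ω₂ then 1 else 0) := by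
  have h1 : ∀ ω₁ ω₂, (if ∃ ω, f ω = f ω₁ ∧ h ω = h ω₂ then (1 : ℝ) else 0) =
      ∑ ω, if f ω = f ω₁ ∧ h ω = h ω₂ then p ω / fib p (fun ω => (f ω, h ω)) ω else 0 := by
    intro ω₁ ω₂
    split_ifs with hex
    · obtain ⟨ω₃, h3, h4⟩ := hex
      have : ∀ ω, (if f ω = f ω₁ ∧ h ω = h ω₂ then p ω / fib p (fun ω => (f ω, h ω)) ω else 0) =
          (if (f ω, h ω) = (f ω₃, h ω₃) then p ω else 0) / fib p (fun ω => (f ω, h ω)) ω₃ := by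
        intro ω
        simp only [h3, h4, Prod.mk.injEq]
        split_ifs with hc
        · unfold fib; simp only [hc, h3, h4]
        · simp
      rw [Finset.sum_congr rfl fun ω _ => this ω, ← Finset.sum_div]
      rw [eq_div_iff (fib_pos hp (fun ω => (f ω, h ω)) ω₃).ne', one_mul]
      unfold fib
      refine Finset.sum_congr rfl fun i _ => ?_
      congr
    · rw [Finset.sum_eq_zero]
      intro ω _
      rw [if_neg]
      exact fun hc => hex ⟨ω, hc⟩
  simp only [h1, Finset.mul_sum]
  have h2 : ∀ ω, p ω * (fib p f ω * fib p h ω / fib p (fun ω => (f ω, h ω)) ω) =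
      ∑ ω₁, ∑ ω₂, p ω₁ * p ω₂ *
        (if f ω = f ω₁ ∧ h ω = h ω₂ then p ω / fib p (fun ω => (f ω, h ω)) ω else 0) := by
    intro ω
    have h3 : fib p f ω * fib p h ω = ∑ ω₁, ∑ ω₂, p ω₁ * p ω₂ *
        (if f ω = f ω₁ ∧ h ω = h ω₂ then 1 else 0) := by
      rw [fib, fib, Finset.sum_mul_sum]
      refine Finset.sum_congr rfl fun ω₁ _ => Finset.sum_congr rfl fun ω₂ _ => ?_
      by_cases c1 : f ω₁ = f ω <;> by_cases c2 : h ω₂ = h ω <;>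
        simp [c1, c2, eq_comm]
      · intro c; exact absurd c.symm c2
      · intro c; exact absurd c.symm c1
      · intro c; exact absurd c.symm c1
    rw [h3, Finset.sum_div, Finset.mul_sum]
    refine Finset.sum_congr rfl fun ω₁ _ => ?_
    rw [Finset.sum_div, Finset.mul_sum]
    refine Finset.sum_congr rfl fun ω₂ _ => ?_
    split_ifs <;> ring
  rw [Finset.sum_congr rfl fun ω _ => h2 ω, Finset.sum_comm]
  refine Finset.sum_congr rfl fun ω₁ _ => ?_
  rw [Finset.sum_comm]

variable (hs : ∑ ω, p ω = 1)
include hs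

theorem ratio_le_one {β γ : Type} (f : Ω → β) (h : Ω → γ) :
    ∑ ω₁, ∑ ω₂, p ω₁ * p ω₂ * (if ∃ ω, f ω = f ω₁ ∧ h ω = h ω₂ then 1 else 0) ≤ 1 ∧
    (∑ ω₁, ∑ ω₂, p ω₁ * p ω₂ * (if ∃ ω, f ω = f ω₁ ∧ h ω = h ω₂ then 1 else 0) = 1 →
      ∀ ω₁ ω₂, ∃ ω, f ω = f ω₁ ∧ h ω = h ω₂) := by
  have h1 : (1 : ℝ) = ∑ ω₁, ∑ ω₂, p ω₁ * p ω₂ := by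
    rw [← Finset.sum_mul_sum, hs]; norm_num
  have h2 : ∀ ω₁ ω₂, p ω₁ * p ω₂ * (if ∃ ω, f ω = f ω₁ ∧ h ω = h ω₂ then 1 else 0) ≤
      p ω₁ * p ω₂ := by
    intro ω₁ ω₂
    have := mul_pos (hp ω₁) (hp ω₂)
    split_ifs <;> simp [this.le]
  constructor
  · conv_rhs => rw [h1]
    exact Finset.sum_le_sum fun ω₁ _ => Finset.sum_le_sum fun ω₂ _ => h2 ω₁ ω₂
  · intro he ω₁ ω₂
    conv_rhs at he => rw [h1]
    have h3 := (Finset.sum_eq_sum_iff_of_le fun ω₁ _ =>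
      Finset.sum_le_sum fun ω₂ _ => h2 ω₁ ω₂).1 he ω₁ (Finset.mem_univ _)
    have h4 := (Finset.sum_eq_sum_iff_of_le fun ω₂ _ => h2 ω₁ ω₂).1 h3 ω₂ (Finset.mem_univ _)
    by_contra hne
    have := mul_pos (hp ω₁) (hp ω₂)
    simp only [hne, if_false, mul_zero] at h4
    linarith

theorem ent_defect {β γ : Type} (f : Ω → β) (h : Ω → γ) :
    1 - ∑ ω₁, ∑ ω₂, p ω₁ * p ω₂ * (if ∃ ω, f ω = f ω₁ ∧ h ω = h ω₂ then 1 else 0) ≤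
    ent p f + ent p h - ent p (fun ω => (f ω, h ω)) := by
  rw [← sum_ratio hp f h]
  conv_lhs => rw [← hs]
  unfold ent
  rw [← Finset.sum_sub_distrib]
  have : -∑ ω, p ω * Real.log (fib p f ω) + -∑ ω, p ω * Real.log (fib p h ω) -
      -∑ ω, p ω * Real.log (fib p (fun ω => (f ω, h ω)) ω) =
      ∑ ω, (-(p ω * Real.log (fib p f ω)) + -(p ω * Real.log (fib p h ω)) -
        -(p ω * Real.log (fib p (fun ω => (f ω, h ω)) ω))) := by
    simp only [Finset.sum_sub_distrib, Finset.sum_add_distrib, Finset.sum_neg_distrib]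
  rw [this]
  refine Finset.sum_le_sum fun ω _ => ?_
  have a1 := fib_pos hp f ω
  have a2 := fib_pos hp h ω
  have a3 := fib_pos hp (fun ω => (f ω, h ω)) ω
  have hl := Real.log_le_sub_one_of_pos (div_pos (mul_pos a1 a2) a3)
  rw [Real.log_div (mul_pos a1 a2).ne' a3.ne', Real.log_mul a1.ne' a2.ne'] at hl
  nlinarith [hp ω, mul_le_mul_of_nonneg_left hl (hp ω).le]

theorem ent_indep_nonneg {β γ : Type} (f : Ω → β) (h : Ω → γ) :
    0 ≤ ent p f + ent p h - ent p (fun ω => (f ω, h ω)) := by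
  have := ent_defect hp hs f h
  have := (ratio_le_one hp hs f h).1
  linarith

theorem prod_of_ent_eq {β γ : Type} (f : Ω → β) (h : Ω → γ)
    (he : ent p f + ent p h - ent p (fun ω => (f ω, h ω)) = 0) :
    ∀ ω₁ ω₂, ∃ ω, f ω = f ω₁ ∧ h ω = h ω₂ := by
  have h1 := ent_defect hp hs f h
  have h2 := ratio_le_one hp hs f h
  exact h2.2 (by linarith [h2.1])

end finite

end UndecCII
end

open scoped Classical
noncomputable section

namespace UndecCII

/-- The diagonal partial recursive function. -/
def diagU (n : ℕ) : Part ℕ := Nat.Partrec.Code.eval (Denumerable.ofNat Nat.Partrec.Code n) n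

theorem diagU_partrec : Partrec diagU :=
  Nat.Partrec.Code.eval_part.comp (Computable.ofNat _) Computable.id

/-- No computable function separates the `0`-outputs from the `1`-outputs of `diagU`. -/
theorem diagU_inseparable (d : ℕ → Bool) (hd : Computable d)
    (h0 : ∀ n, 0 ∈ diagU n → d n = true) (h1 : ∀ n, 1 ∈ diagU n → d n = false) : False := by
  have hg : Computable (fun n : ℕ => cond (d n) 1 0) :=
    Computable.cond hd (Computable.const 1) (Computable.const 0)
  have hp : Nat.Partrec (fun n : ℕ => Part.some (cond (d n) 1 0)) :=
    Partrec.nat_iff.1 hg.partrec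
  obtain ⟨c, hc⟩ := Nat.Partrec.Code.exists_code.1 hp
  have key : diagU (Encodable.encode c) = Part.some (cond (d (Encodable.encode c)) 1 0) := by
    unfold diagU
    rw [Denumerable.ofNat_encode, hc]
  cases hb : d (Encodable.encode c)
  · have := h0 (Encodable.encode c) (by rw [key, hb]; simp)
    rw [hb] at this; cases this
  · have := h1 (Encodable.encode c) (by rw [key, hb]; simp)
    rw [hb] at this; cases this

theorem pow2_prim : Primrec (fun m : ℕ => 2 ^ m) := by
  have : Primrec (fun m : ℕ => Nat.rec (motive := fun _ => ℕ) 1 (fun _ r => 2 * r) m) := by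
    refine Primrec.nat_rec₁ 1 (f := fun _ r => 2 * r) ?_
    exact Primrec.nat_mul.comp (Primrec.const 2) Primrec.snd
  refine this.of_eq fun m => ?_
  induction m with
  | zero => rfl
  | succ m ih => simp only [ih, pow_succ]; ring

/-- `diagU` composed with (a partial version of) the binary logarithm. -/
def diagV (k : ℕ) : Part ℕ :=
  (Nat.rfind fun m => Part.some (decide (2 ^ m = k))).bind diagU

theorem diagV_partrec : Partrec diagV := by
  unfold diagV
  refine Partrec.bind (Partrec.rfind ?_) (diagU_partrec.comp Computable.snd).to₂
  have : Primrec₂ (fun (k m : ℕ) => decide (2 ^ m = k)) := by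
    have h := (Primrec.eq (α := ℕ)).comp (pow2_prim.comp Primrec.snd) (Primrec.fst (α := ℕ) (β := ℕ))
    exact (h.decide).to₂.of_eq (fun a b => by simp)
  exact this.to_comp.partrec₂

theorem diagV_pow (m : ℕ) : diagV (2 ^ m) = diagU m := by
  unfold diagV
  have : m ∈ (Nat.rfind fun m' => Part.some (decide (2 ^ m' = 2 ^ m))) := by
    refine Nat.mem_rfind.2 ⟨by simp, fun {k} hk => ?_⟩
    simp; omega
  rw [Part.eq_some_iff.2 this, Part.bind_some]

open Turing

theorem exists_code_diag : ∃ c : ToPartrec.Code, ∀ m : ℕ,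
    (0 ∈ diagU m → [] ∈ c.eval [2 ^ m]) ∧ (1 ∈ diagU m → [0, 0] ∈ c.eval [2 ^ m]) := by
  obtain ⟨c, hc⟩ := ToPartrec.Code.exists_code (Nat.Partrec'.part_iff₁.2 diagV_partrec)
  refine ⟨(ToPartrec.Code.case ToPartrec.Code.tail ToPartrec.Code.zero').comp c, fun m => ?_⟩
  have h := hc (2 ^ m ::ᵥ List.Vector.nil)
  have h' : c.eval [2 ^ m] = pure <$> diagU m := by
    rw [← diagV_pow]; exact h
  constructor
  · intro h0
    rw [Part.eq_some_iff.2 h0] at h'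
    simp [h', pure]
  · intro h0
    rw [Part.eq_some_iff.2 h0] at h'
    simp [h', pure]

theorem trNat_pow (m : ℕ) : PartrecToTM2.trNat (2 ^ m) =
    List.replicate m PartrecToTM2.Γ'.bit0 ++ [PartrecToTM2.Γ'.bit1] := by
  have : ∀ m : ℕ, ∃ p : PosNum, ((2 ^ m : ℕ) : Num) = Num.pos p ∧ PartrecToTM2.trPosNum p =
      List.replicate m PartrecToTM2.Γ'.bit0 ++ [PartrecToTM2.Γ'.bit1] := by
    intro m
    induction m with
    | zero => exact ⟨1, by simp; rfl, rfl⟩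
    | succ m ih =>
      obtain ⟨p, hp, hq⟩ := ih
      refine ⟨PosNum.bit0 p, ?_, ?_⟩
      · rw [pow_succ, mul_two, Nat.cast_add, hp]
        rw [Num.bit0_of_bit0]; rfl
      · rw [PartrecToTM2.trPosNum, hq, List.replicate_succ]; rfl
  obtain ⟨p, hp, hq⟩ := this m
  rw [PartrecToTM2.trNat, hp, PartrecToTM2.trNum, hq]


theorem tm_chain (c : ToPartrec.Code) :
    ∃ (Γ Λ : Type) (_ : Inhabited Γ) (_ : Inhabited Λ) (_ : Finite Γ) (M : TM0.Machine Γ Λ)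
      (S : Finset Λ) (acc : Γ → Prop) (l0 : List Γ) (cc : Γ),
      TM0.Supports M (S : Set Λ) ∧
      ∀ m : ℕ,
        ([] ∈ c.eval [2 ^ m] → ∃ cfg ∈ StateTransition.eval (TM0.step M)
          (TM0.init (l0 ++ List.replicate m cc)), acc cfg.Tape.head) ∧
        ([0, 0] ∈ c.eval [2 ^ m] → ∃ cfg ∈ StateTransition.eval (TM0.step M)
          (TM0.init (l0 ++ List.replicate m cc)), ¬ acc cfg.Tape.head) := by
  let iΛ : Inhabited PartrecToTM2.Λ' := ⟨PartrecToTM2.trNormal c PartrecToTM2.Cont'.halt⟩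
  have hs2 := PartrecToTM2.tr_supports c PartrecToTM2.Cont'.halt
  have hs1 := TM2to1.tr_supports PartrecToTM2.tr hs2
  have hs0 := TM1to0.tr_supports (TM2to1.tr PartrecToTM2.tr) hs1
  let upd : PartrecToTM2.Γ' → (∀ _ : PartrecToTM2.K', Option PartrecToTM2.Γ') :=
    fun a => Function.update (fun _ => none) PartrecToTM2.K'.main (some a)
  have main : ∀ (m : ℕ) (v : List ℕ), v ∈ c.eval [2 ^ m] →
      ∃ cfg ∈ StateTransition.eval (TM0.step (TM1to0.tr (TM2to1.tr PartrecToTM2.tr)))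
        (TM0.init (TM2to1.trInit PartrecToTM2.K'.main (PartrecToTM2.trList [2 ^ m]))),
        cfg.Tape.head.2 PartrecToTM2.K'.main = (PartrecToTM2.trList v).reverse[0]? := by
    intro m v hv
    have h2 : PartrecToTM2.halt v ∈ StateTransition.eval (TM2.step PartrecToTM2.tr)
        (PartrecToTM2.init c [2 ^ m]) := by
      rw [PartrecToTM2.tr_eval]
      exact (Part.mem_map_iff _).2 ⟨v, hv, rfl⟩
    have hi : PartrecToTM2.init c [2 ^ m] =
        TM2.init PartrecToTM2.K'.main (PartrecToTM2.trList [2 ^ m]) := by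
      unfold PartrecToTM2.init TM2.init
      congr 1
      funext k
      cases k <;> rfl
    rw [hi] at h2
    obtain ⟨c1, ht, h1⟩ := StateTransition.tr_eval (TM2to1.tr_respects PartrecToTM2.tr)
      (TM2to1.trCfg_init PartrecToTM2.K'.main (PartrecToTM2.trList [2 ^ m])) h2
    obtain ⟨c0, ht0, h0⟩ := StateTransition.tr_eval
      (TM1to0.tr_respects (TM2to1.tr PartrecToTM2.tr)) rfl h1
    refine ⟨c0, h0, ?_⟩
    subst ht0
    obtain ⟨L, hL⟩ := ht
    have := TM2to1.stk_nth_val 0 (hL PartrecToTM2.K'.main)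
    simp only [TM1to0.trCfg, Tape.mk'_head]
    rw [← ListBlank.nth_zero, TM2to1.addBottom_nth_snd]
    exact this
  have hin : ∀ m : ℕ, TM2to1.trInit PartrecToTM2.K'.main (PartrecToTM2.trList [2 ^ m]) =
      [((true, upd .cons) : TM2to1.Γ' PartrecToTM2.K' fun _ => PartrecToTM2.Γ'),
        (false, upd .bit1)] ++ List.replicate m (false, upd .bit0) := by
    intro m
    rw [PartrecToTM2.trList, trNat_pow, PartrecToTM2.trList]
    have hr : (List.replicate m PartrecToTM2.Γ'.bit0 ++ [PartrecToTM2.Γ'.bit1] ++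
        [PartrecToTM2.Γ'.cons]).reverse = PartrecToTM2.Γ'.cons :: PartrecToTM2.Γ'.bit1 ::
          List.replicate m PartrecToTM2.Γ'.bit0 := by simp
    unfold TM2to1.trInit
    rw [hr]
    exact congrArg (fun t : List (TM2to1.Γ' PartrecToTM2.K' fun _ => PartrecToTM2.Γ') =>
      (true, upd .cons) :: (false, upd .bit1) :: t)
      (List.map_replicate (f := fun a => ((false, upd a) :
        TM2to1.Γ' PartrecToTM2.K' fun _ => PartrecToTM2.Γ')))
  have hΓ : Finite PartrecToTM2.Γ' :=
    Finite.of_injective (fun g : PartrecToTM2.Γ' => (match g with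
      | .consₗ => 0 | .cons => 1 | .bit0 => 2 | .bit1 => 3 : Fin 4))
      (by intro a b; cases a <;> cases b <;> simp)
  have hK : Finite PartrecToTM2.K' :=
    Finite.of_injective (fun g : PartrecToTM2.K' => (match g with
      | .main => 0 | .rev => 1 | .aux => 2 | .stack => 3 : Fin 4))
      (by intro a b; cases a <;> cases b <;> simp)
  have hF : Finite (TM2to1.Γ' PartrecToTM2.K' fun _ => PartrecToTM2.Γ') := by
    unfold TM2to1.Γ'; infer_instance
  refine ⟨TM2to1.Γ' PartrecToTM2.K' fun _ => PartrecToTM2.Γ',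
    TM1to0.Λ' (TM2to1.tr PartrecToTM2.tr), inferInstance, inferInstance, hF,
    TM1to0.tr (TM2to1.tr PartrecToTM2.tr), _,
    fun g => g.2 PartrecToTM2.K'.main = none,
    [(true, upd .cons), (false, upd .bit1)], (false, upd .bit0), hs0, ?_⟩
  intro m
  constructor
  · intro h
    obtain ⟨cfg, h1, h2⟩ := main m _ h
    rw [hin] at h1
    exact ⟨cfg, h1, h2.trans rfl⟩
  · intro h
    obtain ⟨cfg, h1, h2⟩ := main m _ h
    rw [hin] at h1
    refine ⟨cfg, h1, fun h3 => ?_⟩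
    have h4 := h2.symm.trans h3
    simp [PartrecToTM2.trList] at h4

/-- A Turing machine with finitely many states which, on input `l0 ++ cc^m`, halts in an accepting
configuration if `0 ∈ diagU m` and in a rejecting one if `1 ∈ diagU m`. -/
theorem exists_tm :
    ∃ (Γ Λ : Type) (_ : Inhabited Γ) (_ : Inhabited Λ) (_ : Finite Γ) (M : TM0.Machine Γ Λ)
      (S : Finset Λ) (acc : Γ → Prop) (l0 : List Γ) (cc : Γ),
      TM0.Supports M (S : Set Λ) ∧
      ∀ m : ℕ,
        (0 ∈ diagU m → ∃ cfg ∈ StateTransition.eval (TM0.step M)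
          (TM0.init (l0 ++ List.replicate m cc)), acc cfg.Tape.head) ∧
        (1 ∈ diagU m → ∃ cfg ∈ StateTransition.eval (TM0.step M)
          (TM0.init (l0 ++ List.replicate m cc)), ¬ acc cfg.Tape.head) := by
  obtain ⟨c, hc⟩ := exists_code_diag
  obtain ⟨Γ, Λ, i1, i2, i3, M, S, acc, l0, cc, hs, h⟩ := tm_chain c
  exact ⟨Γ, Λ, i1, i2, i3, M, S, acc, l0, cc, hs, fun m =>
    ⟨fun h0 => (h m).1 ((hc m).1 h0), fun h1 => (h m).2 ((hc m).2 h1)⟩⟩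

end UndecCII
end

open scoped Classical
noncomputable section

namespace UndecCII

open Turing

/-- Letters of the rewriting system associated with a Turing machine. -/
inductive Lt (Γ Λ : Type) : Type
  | sym (g : Γ) : Lt Γ Λ
  | st (q : Λ) : Lt Γ Λ
  | lm : Lt Γ Λ
  | rm : Lt Γ Λ
  | hm : Lt Γ Λ

/-- Whether a letter is a state. -/
def Lt.isSt {Γ Λ : Type} : Lt Γ Λ → Bool
  | .st _ => true
  | _ => false

/-- Whether a letter is the halting symbol. -/
def Lt.isH {Γ Λ : Type} : Lt Γ Λ → Bool
  | .hm => true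
  | _ => false

instance {Γ Λ : Type} [Finite Γ] [Finite Λ] : Finite (Lt Γ Λ) := by
  refine Finite.of_injective (β := Γ ⊕ Λ ⊕ Fin 3) (fun x => match x with
    | .sym g => .inl g
    | .st q => .inr (.inl q)
    | .lm => .inr (.inr 0)
    | .rm => .inr (.inr 1)
    | .hm => .inr (.inr 2)) ?_
  intro a b
  cases a <;> cases b <;> simp

section words

variable {Γ Λ : Type} [Inhabited Γ] [Inhabited Λ] (M : TM0.Machine Γ Λ) (acc : Γ → Prop)

/-- The rewriting rules simulating the machine. -/
inductive Rule : List (Lt Γ Λ) → List (Lt Γ Λ) → Prop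
  | ext (q : Λ) : Rule [.st q, .rm] [.st q, .sym default, .rm]
  | write (q : Λ) (a : Γ) (q' : Λ) (a' : Γ) : M q a = some (q', TM0.Stmt.write a') →
      Rule [.st q, .sym a] [.st q', .sym a']
  | right (q : Λ) (a : Γ) (q' : Λ) : M q a = some (q', TM0.Stmt.move Dir.right) →
      Rule [.st q, .sym a] [.sym a, .st q']
  | left (b : Γ) (q : Λ) (a : Γ) (q' : Λ) : M q a = some (q', TM0.Stmt.move Dir.left) →
      Rule [.sym b, .st q, .sym a] [.st q', .sym b, .sym a]
  | leftL (q : Λ) (a : Γ) (q' : Λ) : M q a = some (q', TM0.Stmt.move Dir.left) →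
      Rule [.lm, .st q, .sym a] [.lm, .st q', .sym default, .sym a]

/-- The rules concerning the halting symbol. -/
inductive HRule : List (Lt Γ Λ) → List (Lt Γ Λ) → Prop
  | acc (q : Λ) (a : Γ) : M q a = none → acc a → HRule [.st q, .sym a] [.hm]
  | absL (x : Lt Γ Λ) : HRule [x, .hm] [.hm]
  | absR (x : Lt Γ Λ) : HRule [.hm, x] [.hm]

/-- One-step rewriting. -/
def Red (u v : List (Lt Γ Λ)) : Prop :=
  ∃ x y l r, Rule M l r ∧ u = x ++ l ++ y ∧ v = x ++ r ++ y

/-- Words with exactly one state and no halting symbol. -/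
def Good (w : List (Lt Γ Λ)) : Prop := w.countP Lt.isSt = 1 ∧ w.countP Lt.isH = 0

variable {M}

theorem Rule.counts {l r : List (Lt Γ Λ)} (h : Rule M l r) :
    l.countP Lt.isSt = 1 ∧ r.countP Lt.isSt = 1 ∧ l.countP Lt.isH = 0 ∧ r.countP Lt.isH = 0 ∧
      l.length ≤ r.length ∧ r.length ≤ 4 := by
  cases h <;> simp [List.countP_cons, Lt.isSt, Lt.isH]

theorem Red.good_iff {u v : List (Lt Γ Λ)} (h : Red M u v) : Good u ↔ Good v := by
  obtain ⟨x, y, l, r, hr, rfl, rfl⟩ := h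
  obtain ⟨h1, h2, h3, h4, -⟩ := hr.counts
  simp [Good, List.countP_append, h1, h2, h3, h4]

theorem Red.length_le {u v : List (Lt Γ Λ)} (h : Red M u v) : u.length ≤ v.length := by
  obtain ⟨x, y, l, r, hr, rfl, rfl⟩ := h
  obtain ⟨-, -, -, -, h, -⟩ := hr.counts
  simp; omega

theorem split_unique {x y x' y' : List (Lt Γ Λ)} {q q' : Λ}
    (hg : Good (x ++ .st q :: y)) (h : x ++ .st q :: y = x' ++ .st q' :: y') :
    x = x' ∧ q = q' ∧ y = y' := by
  have hg' := hg
  rw [h] at hg'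
  have key : ∀ (x y : List (Lt Γ Λ)) (q : Λ), Good (x ++ .st q :: y) →
      (x ++ .st q :: y).takeWhile (fun e => !e.isSt) = x := by
    intro x y q hg
    have h0 : x.countP Lt.isSt = 0 := by
      have := hg.1
      simp [List.countP_append, List.countP_cons, Lt.isSt] at this
      omega
    rw [List.countP_eq_zero] at h0
    rw [List.takeWhile_append_of_pos (by intro a ha; simpa using h0 a ha)]
    simp [Lt.isSt]
  have hx : x = x' := by rw [← key x y q hg, h, key x' y' q' hg']
  subst hx
  simpa using h

theorem Red.det {u v v' : List (Lt Γ Λ)} (hg : Good u) (h : Red M u v) (h' : Red M u v') :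
    v = v' := by
  obtain ⟨x, y, l, r, hr, rfl, rfl⟩ := h
  obtain ⟨x', y', l', r', hr', he, rfl⟩ := h'
  have e1 : ∀ (x y : List (Lt Γ Λ)) (a b c : Lt Γ Λ),
      x ++ [a, b, c] ++ y = (x ++ [a]) ++ b :: ([c] ++ y) := by intros; simp
  have e2 : ∀ (x y : List (Lt Γ Λ)) (b c : Lt Γ Λ),
      x ++ [b, c] ++ y = x ++ b :: ([c] ++ y) := by intros; simp
  cases hr <;> cases hr' <;> simp only [e1, e2] at he hg <;>
    (obtain ⟨h1, h2, h3⟩ := split_unique hg he) <;> simp_all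

/-- A word with the machine halted is irreducible. -/
theorem irred_of_none {x y : List (Lt Γ Λ)} {q : Λ} {a : Γ}
    (hg : Good (x ++ .st q :: .sym a :: y)) (hM : M q a = none) (v : List (Lt Γ Λ)) :
    ¬ Red M (x ++ .st q :: .sym a :: y) v := by
  rintro ⟨x', y', l', r', hr', he, rfl⟩
  have e1 : ∀ (x y : List (Lt Γ Λ)) (a b c : Lt Γ Λ),
      x ++ [a, b, c] ++ y = (x ++ [a]) ++ b :: ([c] ++ y) := by intros; simp
  have e2 : ∀ (x y : List (Lt Γ Λ)) (b c : Lt Γ Λ),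
      x ++ [b, c] ++ y = x ++ b :: ([c] ++ y) := by intros; simp
  cases hr' <;> simp only [e1, e2] at he <;>
    (obtain ⟨h1, h2, h3⟩ := split_unique hg he) <;> simp_all

/-- Encoding of a configuration. -/
def Enc (l : List Γ) (q : Λ) (r : List Γ) : List (Lt Γ Λ) :=
  (.lm :: l.reverse.map .sym) ++ .st q :: (r.map .sym ++ [.rm])

theorem good_enc (l : List Γ) (q : Λ) (r : List Γ) : Good (Enc l q r) := by
  have h1 : ∀ l : List Γ, (l.map (Lt.sym (Λ := Λ))).countP Lt.isSt = 0 := by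
    intro l; rw [List.countP_eq_zero]; simp [Lt.isSt]
  have h2 : ∀ l : List Γ, (l.map (Lt.sym (Λ := Λ))).countP Lt.isH = 0 := by
    intro l; rw [List.countP_eq_zero]; simp [Lt.isH]
  constructor
  · simp only [Enc, List.countP_append, List.countP_cons, h1, List.countP_nil]; simp [Lt.isSt]
  · simp only [Enc, List.countP_append, List.countP_cons, h2, List.countP_nil]; simp [Lt.isH]

/-- A word represents a configuration. -/
def Rep (w : List (Lt Γ Λ)) (cfg : TM0.Cfg Γ Λ) : Prop :=
  ∃ l r, w = Enc l cfg.q r ∧ cfg.Tape = Tape.mk' (ListBlank.mk l) (ListBlank.mk r)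

theorem mk_snoc_default (l : List Γ) : ListBlank.mk (l ++ [default]) = ListBlank.mk l := by
  refine ListBlank.ext fun i => ?_
  simp only [ListBlank.nth_mk]
  rcases lt_or_ge i l.length with h | h
  · rw [List.getI_append _ _ _ h]
  · rw [List.getI_append_right _ _ _ h, List.getI_eq_default l h]
    rcases Nat.eq_zero_or_pos (i - l.length) with h' | h'
    · rw [h']; rfl
    · rw [List.getI_eq_default]; simp only [List.length_singleton]; omega

/-- One may assume that the right part is nonempty. -/
theorem Rep.cons {w : List (Lt Γ Λ)} {cfg : TM0.Cfg Γ Λ} (h : Rep w cfg) :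
    ∃ l r, Relation.ReflTransGen (Red M) w (Enc l cfg.q (cfg.Tape.head :: r)) ∧
      cfg.Tape = Tape.mk' (ListBlank.mk l) (ListBlank.mk (cfg.Tape.head :: r)) := by
  obtain ⟨l, r, rfl, hT⟩ := h
  have hh : cfg.Tape.head = r.headI := by rw [hT]; simp
  cases r with
  | nil =>
    refine ⟨l, [], Relation.ReflTransGen.single ?_, ?_⟩
    · refine ⟨.lm :: l.reverse.map .sym, [], _, _, Rule.ext cfg.q, ?_, ?_⟩
      · simp [Enc]
      · simp [Enc, hh]
    · rw [hh]
      have := mk_snoc_default ([] : List Γ)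
      simp only [List.nil_append] at this
      conv_lhs => rw [hT, ← this]
      rfl
  | cons a r =>
    simp only [List.headI] at hh
    exact ⟨l, r, by rw [hh], by rw [hh]; exact hT⟩

theorem Rep.step {w : List (Lt Γ Λ)} {cfg cfg' : TM0.Cfg Γ Λ} (h : Rep w cfg)
    (hs : cfg' ∈ TM0.step M cfg) :
    ∃ w', Relation.ReflTransGen (Red M) w w' ∧ Rep w' cfg' := by
  obtain ⟨l, r, hw, hT⟩ := h.cons (M := M)
  obtain ⟨q, T⟩ := cfg
  simp only [TM0.step, Option.mem_def, Option.map_eq_some_iff] at hs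
  obtain ⟨⟨q', s⟩, hM, rfl⟩ := hs
  simp only at hT hw
  generalize T.head = a at hT hw hM
  subst hT
  cases s with
  | write a' =>
    refine ⟨Enc l q' (a' :: r), hw.tail ?_, l, a' :: r, rfl, ?_⟩
    · exact ⟨.lm :: l.reverse.map .sym, r.map .sym ++ [.rm], _, _, Rule.write _ _ _ _ hM,
        by simp [Enc], by simp [Enc]⟩
    · simp
  | move d =>
    cases d with
    | right =>
      refine ⟨Enc (a :: l) q' r, hw.tail ?_, a :: l, r, rfl, ?_⟩
      · exact ⟨.lm :: l.reverse.map .sym, r.map .sym ++ [.rm], _, _, Rule.right _ _ _ hM,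
          by simp [Enc], by simp [Enc]⟩
      · simp
    | left =>
      cases l with
      | nil =>
        refine ⟨Enc [] q' (default :: a :: r), hw.tail ?_, [], default :: a :: r, rfl, ?_⟩
        · exact ⟨[], r.map .sym ++ [.rm], _, _, Rule.leftL _ _ _ hM,
            by simp [Enc], by simp [Enc]⟩
        · simp
      | cons b l =>
        refine ⟨Enc l q' (b :: a :: r), hw.tail ?_, l, b :: a :: r, rfl, ?_⟩
        · exact ⟨.lm :: l.reverse.map .sym, r.map .sym ++ [.rm], _, _, Rule.left b _ _ _ hM,
            by simp [Enc], by simp [Enc]⟩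
        · simp

theorem Rep.reaches {w : List (Lt Γ Λ)} {cfg cfg' : TM0.Cfg Γ Λ} (h : Rep w cfg)
    (hs : StateTransition.Reaches (TM0.step M) cfg cfg') :
    ∃ w', Relation.ReflTransGen (Red M) w w' ∧ Rep w' cfg' := by
  induction hs with
  | refl => exact ⟨w, .refl, h⟩
  | tail _ h2 ih =>
    obtain ⟨w', hw, hr⟩ := ih
    obtain ⟨w'', hw', hr'⟩ := hr.step h2
    exact ⟨w'', hw.trans hw', hr'⟩

theorem rep_init (l : List Γ) : Rep (Enc [] (default : Λ) l) (TM0.init l) :=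
  ⟨[], l, rfl, rfl⟩

/-- If the machine halts, the initial word rewrites to a word with a halted configuration. -/
theorem eval_word {l : List Γ} {cfg : TM0.Cfg Γ Λ}
    (h : cfg ∈ StateTransition.eval (TM0.step M) (TM0.init l)) :
    ∃ l' r', Relation.ReflTransGen (Red M) (Enc [] (default : Λ) l)
      (Enc l' cfg.q (cfg.Tape.head :: r')) ∧ M cfg.q cfg.Tape.head = none := by
  rw [StateTransition.mem_eval] at h
  obtain ⟨w, hw, hr⟩ := (rep_init l).reaches h.1
  obtain ⟨l', r', h1, -⟩ := hr.cons (M := M)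
  refine ⟨l', r', hw.trans h1, ?_⟩
  have := h.2
  obtain ⟨q, T⟩ := cfg
  simpa [TM0.step] using this

end words

end UndecCII
end

open scoped Classical
noncomputable section

namespace UndecCII

open Turing

/-- As `exists_tm` with a finite type of states. -/
theorem exists_tm_fin :
    ∃ (Γ Λ : Type) (_ : Inhabited Γ) (_ : Inhabited Λ) (_ : Finite Γ) (_ : Finite Λ)
      (M : TM0.Machine Γ Λ) (acc : Γ → Prop) (l0 : List Γ) (cc : Γ),
      ∀ m : ℕ,
        (0 ∈ diagU m → ∃ cfg ∈ StateTransition.eval (TM0.step M)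
          (TM0.init (l0 ++ List.replicate m cc)), acc cfg.Tape.head) ∧
        (1 ∈ diagU m → ∃ cfg ∈ StateTransition.eval (TM0.step M)
          (TM0.init (l0 ++ List.replicate m cc)), ¬ acc cfg.Tape.head) := by
  obtain ⟨Γ, Λ, i1, i2, i3, M, S, acc, l0, cc, hs, h⟩ := exists_tm
  let i4 : Inhabited S := ⟨⟨default, hs.1⟩⟩
  let g₁ : PointedMap Λ S := ⟨fun q => if hq : q ∈ S then ⟨q, hq⟩ else default, by
    have : (default : Λ) ∈ S := hs.1
    simp only [this, dif_pos]; rfl⟩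
  let f₁ : PointedMap Γ Γ := ⟨id, rfl⟩
  have hr := TM0.Machine.map_respects M f₁ f₁ g₁ (fun q : S => q.1) hs (fun _ => rfl)
    (fun q hq => by
      have hq' : q ∈ S := hq
      simp [g₁, hq'])
  have key : ∀ l cfg, cfg ∈ StateTransition.eval (TM0.step M) (TM0.init l) →
      ∃ cfg' ∈ StateTransition.eval (TM0.step (M.map f₁ f₁ g₁ (fun q : S => q.1)))
        (TM0.init l), cfg'.Tape.head = cfg.Tape.head := by
    intro l cfg hc
    have hi := TM0.map_init f₁ g₁ l
    have hl : l.map f₁ = l := List.map_id l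
    rw [hl] at hi
    obtain ⟨b, ⟨h1, h2⟩, h3⟩ := StateTransition.tr_eval hr ⟨hs.1, hi⟩ hc
    refine ⟨b, h3, ?_⟩
    subst h2
    simp [TM0.Cfg.map]
    rfl
  refine ⟨Γ, S, i1, i4, i3, inferInstance, M.map f₁ f₁ g₁ (fun q : S => q.1), acc, l0, cc,
    fun m => ⟨fun h0 => ?_, fun h0 => ?_⟩⟩
  · obtain ⟨cfg, h1, h2⟩ := (h m).1 h0
    obtain ⟨cfg', h3, h4⟩ := key _ _ h1
    exact ⟨cfg', h3, by rw [h4]; exact h2⟩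
  · obtain ⟨cfg, h1, h2⟩ := (h m).2 h0
    obtain ⟨cfg', h3, h4⟩ := key _ _ h1
    exact ⟨cfg', h3, by rw [h4]; exact h2⟩

/-- `F` is a model of the triples `R`: a transformation representation. -/
def IsModel {P : Type} (R : List (ℕ × ℕ × ℕ)) (F : ℕ → P → P) : Prop :=
  F 0 = id ∧ ∀ t ∈ R, F t.2.2 = F t.2.1 ∘ F t.1

section core
variable {A : Type} [Encodable A] {P : Type}

/-- Action of a word. -/
def act (F : ℕ → P → P) : List A → P → P
  | [] => id
  | x :: w => act F w ∘ F (Encodable.encode [x])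

theorem act_append (F : ℕ → P → P) (u v : List A) : act F (u ++ v) = act F v ∘ act F u := by
  induction u with
  | nil => rfl
  | cons x u ih => simp only [List.cons_append, act, ih]; rfl

theorem act_replicate (F : ℕ → P → P) (x : A) (n : ℕ) :
    act F (List.replicate n x) = (F (Encodable.encode [x]))^[n] := by
  induction n with
  | zero => rfl
  | succ n ih => rw [List.replicate_succ, act, ih, Function.iterate_succ]

end core

theorem core_theorem :
    ∃ (N : ℕ) (R : List (ℕ × ℕ × ℕ)) (u c v t : ℕ),
      0 < N ∧ u < N ∧ c < N ∧ v < N ∧ t < N ∧ (∀ x ∈ R, x.1 < N ∧ x.2.1 < N ∧ x.2.2 < N) ∧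
      ∀ n : ℕ,
        (0 ∈ diagU n → ∀ (P : Type) (F : ℕ → P → P), IsModel R F →
          F v ∘ (F c)^[n] ∘ F u = F t) ∧
        (1 ∈ diagU n → ∃ (P : Type) (_ : Finite P) (F : ℕ → P → P), IsModel R F ∧
          F v ∘ (F c)^[n] ∘ F u ≠ F t) := by
  obtain ⟨Γ, Λ, _, _, _, _, M, acc, l0, cc, h⟩ := exists_tm_fin
  obtain ⟨m, ⟨eq⟩⟩ := Finite.exists_equiv_fin (Lt Γ Λ)
  let _ : Encodable (Lt Γ Λ) := Encodable.ofEquiv _ eq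
  let e : List (Lt Γ Λ) → ℕ := Encodable.encode
  let K : ℕ := l0.length + 4
  let W : Set (List (Lt Γ Λ)) := {w | w.length ≤ K}
  have hW : W.Finite := List.finite_length_le _ _
  let pre : List (Lt Γ Λ) := .lm :: .st default :: l0.map .sym
  let T1 : Set (ℕ × ℕ × ℕ) := (fun p : List (Lt Γ Λ) × List (Lt Γ Λ) =>
    (e p.1, e p.2, e (p.1 ++ p.2))) '' {p | p.1 ∈ W ∧ p.2 ∈ W ∧ p.1 ++ p.2 ∈ W}
  let T2 : Set (ℕ × ℕ × ℕ) := (fun p : List (Lt Γ Λ) × List (Lt Γ Λ) =>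
    (e p.1, 0, e p.2)) '' {p | p.1 ∈ W ∧ p.2 ∈ W ∧ (Rule M p.1 p.2 ∨ HRule M acc p.1 p.2)}
  have hT1 : T1.Finite :=
    Set.Finite.image _ ((hW.prod hW).subset fun p hp => ⟨hp.1, hp.2.1⟩)
  have hT2 : T2.Finite :=
    Set.Finite.image _ ((hW.prod hW).subset fun p hp => ⟨hp.1, hp.2.1⟩)
  obtain ⟨B, hB⟩ := (hW.image e).bddAbove
  have hlt : ∀ w ∈ W, e w < B + 1 := fun w hw => Nat.lt_succ_of_le (hB ⟨w, hw, rfl⟩)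
  have he0 : e [] = 0 := rfl
  have hnil : ([] : List (Lt Γ Λ)) ∈ W := by simp [W]
  have hpre : pre ∈ W := by simp [W, pre, K]
  have hone : ∀ x : Lt Γ Λ, [x] ∈ W := by intro x; simp [W, K]
  have hruleW : ∀ l r : List (Lt Γ Λ), (Rule M l r ∨ HRule M acc l r) → l ∈ W ∧ r ∈ W := by
    intro l r h
    rcases h with h | h
    · have := h.counts; simp only [W, K, Set.mem_setOf_eq]; omega
    · cases h <;> simp [W, K] <;> omega
  have hmemR : ∀ x, x ∈ (hT1.union hT2).toFinset.toList ↔ x ∈ T1 ∨ x ∈ T2 := by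
    intro x; simp
  have henc : ∀ n, Enc [] (default : Λ) (l0 ++ List.replicate n cc) =
      pre ++ (List.replicate n (.sym cc) ++ [.rm]) := by
    intro n; simp [Enc, pre]
  refine ⟨B + 1, (hT1.union hT2).toFinset.toList, e pre, e [.sym cc], e [.rm], e [.hm],
    Nat.succ_pos _, hlt _ hpre, hlt _ (hone _), hlt _ (hone _), hlt _ (hone _), ?_, ?_⟩
  · intro x hx
    rw [hmemR] at hx
    rcases hx with ⟨p, hp, rfl⟩ | ⟨p, hp, rfl⟩
    · exact ⟨hlt _ hp.1, hlt _ hp.2.1, hlt _ hp.2.2⟩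
    · exact ⟨hlt _ hp.1, Nat.succ_pos _, hlt _ hp.2.1⟩
  intro n
  constructor
  · intro h0 P F hF
    have hactW : ∀ w ∈ W, F (e w) = act F w := by
      intro w
      induction w with
      | nil => intro _; exact hF.1
      | cons x w ih =>
        intro hw
        have hw' : w ∈ W := by
          simp only [W, Set.mem_setOf_eq, List.length_cons] at hw ⊢; omega
        have := hF.2 (e [x], e w, e ([x] ++ w))
          ((hmemR _).2 (Or.inl ⟨([x], w), ⟨hone x, hw', hw⟩, rfl⟩))
        rw [act, ← ih hw']
        exact this
    have hrule : ∀ l r, (Rule M l r ∨ HRule M acc l r) → act F l = act F r := by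
      intro l r hlr
      have hw := hruleW l r hlr
      have := hF.2 (e l, 0, e r) ((hmemR _).2 (Or.inr ⟨(l, r), ⟨hw.1, hw.2, hlr⟩, rfl⟩))
      simp only [hF.1] at this
      rw [← hactW l hw.1, ← hactW r hw.2, this]; rfl
    have hctx : ∀ x l r y, (Rule M l r ∨ HRule M acc l r) →
        act F (x ++ l ++ y) = act F (x ++ r ++ y) := by
      intro x l r y hlr
      simp only [act_append, hrule l r hlr]
    have hred : ∀ w w', Relation.ReflTransGen (Red M) w w' → act F w = act F w' := by
      intro w w' hw
      induction hw with
      | refl => rfl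
      | tail _ h2 ih =>
        obtain ⟨x, y, l, r, hr, rfl, rfl⟩ := h2
        rw [ih, hctx _ _ _ _ (Or.inl hr)]
    have habsL : ∀ x : List (Lt Γ Λ), act F (x ++ [.hm]) = act F [Lt.hm (Γ := Γ) (Λ := Λ)] := by
      intro x
      induction x with
      | nil => rfl
      | cons a x ih =>
        rw [List.cons_append, act, ih]
        exact hrule _ _ (Or.inr (HRule.absL a))
    have habsR : ∀ x : List (Lt Γ Λ), act F (.hm :: x) = act F [Lt.hm (Γ := Γ) (Λ := Λ)] := by
      intro x
      induction x with
      | nil => rfl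
      | cons a x ih =>
        have := hctx [] [.hm, a] [.hm] x (Or.inr (HRule.absR a))
        simp only [List.nil_append, List.cons_append] at this
        rw [this, ih]
    obtain ⟨cfg, hc, hacc⟩ := (h n).1 h0
    obtain ⟨l', r', h1, h2⟩ := eval_word hc
    have e1 := hred _ _ h1
    rw [henc, act_append, act_append, act_replicate, ← hactW _ hpre] at e1
    rw [hactW _ (hone .rm), hactW _ (hone .hm)]
    rw [Function.comp_assoc] at e1
    refine e1.trans ?_
    have e2 := hctx (.lm :: l'.reverse.map .sym) [.st cfg.q, .sym cfg.Tape.head] [.hm]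
      (r'.map .sym ++ [.rm]) (Or.inr (HRule.acc _ _ h2 hacc))
    have e3 : Enc l' cfg.q (cfg.Tape.head :: r') =
      (.lm :: l'.reverse.map .sym) ++ [.st cfg.q, .sym cfg.Tape.head] ++
      (r'.map .sym ++ [.rm]) := by simp [Enc]
    rw [e3, e2, List.append_assoc, act_append, List.singleton_append, habsR, ← act_append, habsL]
  · intro h1
    obtain ⟨cfg, hc, hacc⟩ := (h n).2 h1
    obtain ⟨l', r', hred, hM⟩ := eval_word hc
    generalize cfg.q = q at *
    generalize cfg.Tape.head = a at *
    let fw := Enc l' q (a :: r')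
    have hfw : fw = (.lm :: l'.reverse.map .sym) ++ .st q :: .sym a :: (r'.map .sym ++ [.rm]) := by
      simp [fw, Enc]
    have hgfw : Good fw := good_enc _ _ _
    let G : Set (List (Lt Γ Λ)) := {w | Relation.ReflTransGen (Red M) w fw}
    have hGgood : ∀ w ∈ G, Good w := by
      intro w hw
      induction (show Relation.ReflTransGen (Red M) w fw from hw)
        using Relation.ReflTransGen.head_induction_on with
      | refl => exact hgfw
      | head h1 _ ih => exact h1.good_iff.2 (ih ‹_›)
    have hGlen : ∀ w ∈ G, w.length ≤ fw.length := by
      intro w hw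
      induction (show Relation.ReflTransGen (Red M) w fw from hw)
        using Relation.ReflTransGen.head_induction_on with
      | refl => exact le_rfl
      | head h1 _ ih => exact h1.length_le.trans (ih ‹_›)
    have hirr : ∀ v, ¬ Red M fw v := by
      intro v
      rw [hfw]
      exact irred_of_none (hfw ▸ hgfw) hM v
    have hGred : ∀ w w', Red M w w' → (w ∈ G ↔ w' ∈ G) := by
      intro w w' hww
      constructor
      · intro hw
        rcases Relation.ReflTransGen.cases_head (show Relation.ReflTransGen (Red M) w fw from hw)
          with h | ⟨w'', h2, h3⟩
        · subst h; exact absurd hww (hirr _)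
        · rw [Red.det (hGgood w hw) hww h2]; exact h3
      · intro hw
        exact Relation.ReflTransGen.head hww hw
    have hGh : ∀ x y : List (Lt Γ Λ), x ++ .hm :: y ∉ G := by
      intro x y hx
      have := (hGgood _ hx).2
      simp [List.countP_append, List.countP_cons, Lt.isH] at this
    have hGacc : ∀ x y q' a', M q' a' = none → acc a' → x ++ .st q' :: .sym a' :: y ∉ G := by
      intro x y q' a' hM' ha' hx
      rcases Relation.ReflTransGen.cases_head
        (show Relation.ReflTransGen (Red M) _ fw from hx) with h | ⟨w'', h2, h3⟩
      · have hg := hGgood _ hx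
        rw [hfw] at h
        obtain ⟨-, -, h3⟩ := split_unique hg h
        simp at h3
        rw [h3.1] at ha'
        exact hacc ha'
      · exact irred_of_none (hGgood _ hx) hM' _ h2
    have hGrule : ∀ x y l r, (Rule M l r ∨ HRule M acc l r) →
        (x ++ l ++ y ∈ G ↔ x ++ r ++ y ∈ G) := by
      intro x y l r hlr
      rcases hlr with hr | hr
      · exact hGred _ _ ⟨x, y, l, r, hr, rfl, rfl⟩
      · have hh := hGh
        cases hr with
        | acc q' a' h1 h2 =>
          have e1 := hGacc x y q' a' h1 h2
          have e2 := hGh x y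
          simp only [List.append_assoc, List.cons_append, List.nil_append] at *
          exact iff_of_false e1 e2
        | absL z =>
          have e1 := hGh (x ++ [z]) y
          have e2 := hGh x y
          simp only [List.append_assoc, List.cons_append, List.nil_append] at *
          exact iff_of_false e1 e2
        | absR z =>
          have e1 := hGh x (z :: y)
          have e2 := hGh x y
          simp only [List.append_assoc, List.cons_append, List.nil_append] at *
          exact iff_of_false e1 e2
    let sec : List (Lt Γ Λ) → Set (List (Lt Γ Λ)) := fun u => {v | u ++ v ∈ G}
    let P := {S : Set (List (Lt Γ Λ)) // ∃ u, S = sec u}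
    have hP : Finite P := by
      have h1 : ({w : List (Lt Γ Λ) | w.length ≤ fw.length}).Finite := List.finite_length_le _ _
      refine Set.Finite.to_subtype (h1.finite_subsets.subset ?_)
      rintro S ⟨u, rfl⟩ v hv
      have := hGlen _ hv
      simp at this ⊢
      omega
    let dec : ℕ → List (Lt Γ Λ) := fun i => (Encodable.decode i).getD []
    have hdec : ∀ w, dec (e w) = w := by intro w; simp [dec, e]
    let aw : List (Lt Γ Λ) → P → P := fun w S => ⟨{v | w ++ v ∈ S.1}, by
      obtain ⟨S, u, rfl⟩ := S
      exact ⟨u ++ w, by ext v; simp [sec]⟩⟩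
    have haw : ∀ u v, aw (u ++ v) = aw v ∘ aw u := by
      intro u v; funext S; apply Subtype.ext; ext x; simp [aw]
    have haw0 : aw [] = id := by
      funext S; apply Subtype.ext; ext x; simp [aw]
    have hrule : ∀ l r, (Rule M l r ∨ HRule M acc l r) → aw l = aw r := by
      intro l r hlr
      funext S
      obtain ⟨S, u, rfl⟩ := S
      apply Subtype.ext
      ext x
      have := hGrule u x l r hlr
      simpa [aw, sec] using this
    refine ⟨P, hP, fun i => aw (dec i), ⟨?_, ?_⟩, ?_⟩
    · have : dec 0 = [] := hdec []
      simp only [this, haw0]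
    · intro t ht
      rcases (hmemR t).1 ht with ⟨p, hp, rfl⟩ | ⟨p, hp, rfl⟩
      · simp only [hdec, haw]
      · have : dec 0 = [] := hdec []
        simp only [hdec, this, haw0, hrule _ _ hp.2.2]; rfl
    · simp only [hdec]
      have hit : ∀ k, (aw [.sym cc])^[k] = aw (List.replicate k (.sym cc)) := by
        intro k
        induction k with
        | zero => simp [haw0]
        | succ k ih =>
          rw [Function.iterate_succ, ih, ← haw]; rfl
      rw [hit n, ← haw, ← haw]
      intro heq
      have h2 := congrFun heq ⟨sec [], [], rfl⟩
      have h3 : ([] : List (Lt Γ Λ)) ∈ (aw (pre ++ List.replicate n (.sym cc) ++ [.rm])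
          ⟨sec [], [], rfl⟩).1 := by
        simp only [aw, sec, Set.mem_setOf_eq, List.append_nil, List.nil_append]
        rw [List.append_assoc, ← henc]
        exact hred
      rw [h2] at h3
      simp only [aw, sec, Set.mem_setOf_eq, List.append_nil, List.nil_append] at h3
      exact hGh [] [] h3

end UndecCII
end

open scoped Classical
noncomputable section

namespace UndecCII

/-- Bit mask of a list of positions. -/
def mask (l : List ℕ) : ℕ := (l.map (fun i => 2 ^ i)).sum

/-- A constraint `(b, l₁, l₂)`: independence of `l₁, l₂` if `b`, and otherwise
functional dependence of `l₂` on `l₁`. -/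
abbrev Con : Type := Bool × List ℕ × List ℕ

def posM (c : Con) : List ℕ :=
  bif c.1 then [mask c.2.1, mask c.2.2] else [mask c.2.1 + mask c.2.2]

def negM (c : Con) : List ℕ :=
  bif c.1 then [mask c.2.1 + mask c.2.2] else [mask c.2.1]

/-- Coefficient vector of `-∑ constraints`. -/
def coef (k : ℕ) (C : List Con) : List ℚ :=
  (List.range (2 ^ k - 1)).map fun j =>
    ((((C.flatMap negM).count (j + 1) : ℕ) : ℚ) - (((C.flatMap posM).count (j + 1) : ℕ) : ℚ))

def OKc (k : ℕ) (c : Con) : Prop :=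
  c.2.1 ≠ [] ∧ c.2.2 ≠ [] ∧ (c.2.1 ++ c.2.2).Nodup ∧ ∀ i ∈ c.2.1 ++ c.2.2, i < k

theorem mask_append (l l' : List ℕ) : mask (l ++ l') = mask l + mask l' := by
  simp [mask]

theorem mask_testBit {l : List ℕ} (hl : l.Nodup) (i : ℕ) : (mask l).testBit i = true ↔ i ∈ l := by
  have h1 : mask l = ∑ i ∈ l.toFinset, 2 ^ i := by
    rw [List.sum_toFinset _ hl]; rfl
  have h2 := Finset.toFinset_bitIndices_sum_two_pow l.toFinset
  rw [← h1] at h2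
  rw [← Nat.mem_bitIndices, ← List.mem_toFinset, h2, List.mem_toFinset]

theorem mask_pos {l : List ℕ} (hl : l ≠ []) : 0 < mask l := by
  cases l with
  | nil => exact absurd rfl hl
  | cons a l => simp [mask]

theorem mask_lt {l : List ℕ} (hl : l.Nodup) {k : ℕ} (h : ∀ i ∈ l, i < k) : mask l < 2 ^ k := by
  refine Nat.lt_pow_two_of_testBit _ fun i hi => ?_
  by_contra hc
  have := (mask_testBit hl i).1 (by simpa using hc)
  have := h i this
  omega

theorem subset_mask {l : List ℕ} (hl : l.Nodup) (hne : l ≠ []) {k : ℕ} (h : ∀ i ∈ l, i < k) :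
    subsetOfIdx k (mask l - 1) = l.toFinset.image (· + 1) := by
  have := mask_pos hne
  unfold subsetOfIdx
  rw [Nat.sub_add_cancel this]
  congr 1
  ext i
  simp only [Finset.mem_filter, Finset.mem_range, mask_testBit hl, List.mem_toFinset]
  exact ⟨fun h => h.2, fun hi => ⟨h i hi, hi⟩⟩

theorem sum_count (h : ℕ → ℝ) (M : ℕ) (L : List ℕ) (hL : ∀ m ∈ L, 0 < m ∧ m < M) :
    ∑ j ∈ Finset.range (M - 1), (L.count (j + 1) : ℝ) * h j = (L.map fun m => h (m - 1)).sum := by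
  induction L with
  | nil => simp
  | cons a L ih =>
    have h1 := hL a (by simp)
    have := ih fun m hm => hL m (by simp [hm])
    simp only [List.map_cons, List.sum_cons, ← this, List.count_cons, Nat.cast_add, add_mul,
      Finset.sum_add_distrib]
    rw [add_comm]
    congr 1
    rw [Finset.sum_eq_single (a - 1)]
    · have : a - 1 + 1 = a := by omega
      simp [this]
    · intro b _ hb
      have : ¬ a = b + 1 := by omega
      simp [this]
    · intro hh
      simp only [Finset.mem_range] at hh
      omega

/-- Value of a constraint, for the list-indexed entropy function. -/
def cval (H : List ℕ → ℝ) (c : Con) : ℝ :=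
  if c.1 then H c.2.1 + H c.2.2 - H (c.2.1 ++ c.2.2) else H (c.2.1 ++ c.2.2) - H c.2.1

def HL {Ω : Type} (p : Ω → ℝ) {V : ℕ → Type} (X : ∀ i, Ω → V i) (l : List ℕ) : ℝ :=
  jointEntropy p X (l.toFinset.image (· + 1))

theorem entCombo_coef {Ω : Type} (p : Ω → ℝ) {V : ℕ → Type} (X : ∀ i, Ω → V i) (k : ℕ)
    (C : List Con) (hC : ∀ c ∈ C, OKc k c) :
    entCombo p X k (coef k C) = - (C.map (cval (HL p X))).sum := by
  set h : ℕ → ℝ := fun j => jointEntropy p X (subsetOfIdx k j) with hh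
  have key : ∀ l : List ℕ, l.Nodup → l ≠ [] → (∀ i ∈ l, i < k) → h (mask l - 1) = HL p X l := by
    intro l h1 h2 h3
    simp only [hh, HL, subset_mask h1 h2 h3]
  have hm : ∀ l : List ℕ, l.Nodup → l ≠ [] → (∀ i ∈ l, i < k) → 0 < mask l ∧ mask l < 2 ^ k :=
    fun l h1 h2 h3 => ⟨mask_pos h2, mask_lt h1 h3⟩
  have hparts : ∀ c ∈ C, (c.2.1.Nodup ∧ c.2.1 ≠ [] ∧ ∀ i ∈ c.2.1, i < k) ∧
      (c.2.2.Nodup ∧ c.2.2 ≠ [] ∧ ∀ i ∈ c.2.2, i < k) ∧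
      ((c.2.1 ++ c.2.2).Nodup ∧ (c.2.1 ++ c.2.2) ≠ [] ∧ ∀ i ∈ (c.2.1 ++ c.2.2), i < k) := by
    intro c hc
    obtain ⟨h1, h2, h3, h4⟩ := hC c hc
    refine ⟨⟨h3.of_append_left, h1, fun i hi => h4 i (by simp [hi])⟩,
      ⟨h3.of_append_right, h2, fun i hi => h4 i (by simp [hi])⟩, h3, by simp [h1], h4⟩
  have hneg : ∀ m ∈ C.flatMap negM, 0 < m ∧ m < 2 ^ k := by
    intro m hmm
    rw [List.mem_flatMap] at hmm
    obtain ⟨c, hc, hmc⟩ := hmm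
    obtain ⟨⟨a1, a2, a3⟩, ⟨b1, b2, b3⟩, ⟨c1, c2, c3⟩⟩ := hparts c hc
    unfold negM at hmc
    rw [← mask_append] at hmc
    cases hb : c.1 <;> simp [hb] at hmc <;> subst hmc
    · exact hm _ a1 a2 a3
    · exact hm _ c1 c2 c3
  have hpos : ∀ m ∈ C.flatMap posM, 0 < m ∧ m < 2 ^ k := by
    intro m hmm
    rw [List.mem_flatMap] at hmm
    obtain ⟨c, hc, hmc⟩ := hmm
    obtain ⟨⟨a1, a2, a3⟩, ⟨b1, b2, b3⟩, ⟨c1, c2, c3⟩⟩ := hparts c hc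
    unfold posM at hmc
    rw [← mask_append] at hmc
    cases hb : c.1 <;> simp [hb] at hmc
    · subst hmc; exact hm _ c1 c2 c3
    · rcases hmc with rfl | rfl
      · exact hm _ a1 a2 a3
      · exact hm _ b1 b2 b3
  have h1 : entCombo p X k (coef k C) =
      ∑ j ∈ Finset.range (2 ^ k - 1), ((C.flatMap negM).count (j + 1) : ℝ) * h j -
      ∑ j ∈ Finset.range (2 ^ k - 1), ((C.flatMap posM).count (j + 1) : ℝ) * h j := by
    rw [← Finset.sum_sub_distrib]
    unfold entCombo
    refine Finset.sum_congr rfl fun j hj => ?_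
    rw [Finset.mem_range] at hj
    have : (coef k C).getD j 0 =
      ((((C.flatMap negM).count (j + 1) : ℕ) : ℚ) - (((C.flatMap posM).count (j + 1) : ℕ) : ℚ)) := by
      unfold coef
      rw [List.getD_eq_getElem _ _ (by simpa using hj)]
      simp
    rw [this]
    push_cast
    ring
  rw [h1, sum_count h _ _ hneg, sum_count h _ _ hpos]
  clear h1 hneg hpos hC
  induction C with
  | nil => simp
  | cons c C ih =>
    have ih := ih fun c' hc' => hparts c' (by simp [hc'])
    obtain ⟨⟨a1, a2, a3⟩, ⟨b1, b2, b3⟩, ⟨c1, c2, c3⟩⟩ := hparts c (by simp)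
    have e1 := key _ a1 a2 a3
    have e2 := key _ b1 b2 b3
    have e3 := key _ c1 c2 c3
    simp only [List.flatMap_cons, List.map_append, List.sum_append, List.map_cons, List.sum_cons]
    have : ((negM c).map fun m => h (m - 1)).sum - ((posM c).map fun m => h (m - 1)).sum =
        - cval (HL p X) c := by
      unfold negM posM cval
      rw [← mask_append]
      cases hb : c.1 <;> simp [e1, e2, e3]
    linarith

/-- Agreement of two outcomes on the variables in `l`. -/
def Kl {Ω : Type} {W : ℕ → Type} (x : ∀ i, Ω → W i) (l : List ℕ) (ω ω' : Ω) : Prop :=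
  ∀ i ∈ l, x i ω = x i ω'

/-- Combinatorial meaning of a constraint. -/
def Sem {Ω : Type} {W : ℕ → Type} (x : ∀ i, Ω → W i) (c : Con) : Prop :=
  if c.1 then ∀ ω₁ ω₂, ∃ ω, Kl x c.2.1 ω ω₁ ∧ Kl x c.2.2 ω ω₂
  else ∀ ω ω', Kl x c.2.1 ω ω' → Kl x c.2.2 ω ω'

def tup {Ω : Type} {W : ℕ → Type} (x : ∀ i, Ω → W i) (l : List ℕ) (ω : Ω) :
    ∀ i : {i // i ∈ l}, W i.1 := fun i => x i.1 ω

theorem tup_eq {Ω : Type} {W : ℕ → Type} (x : ∀ i, Ω → W i) (l : List ℕ) (ω ω' : Ω) :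
    tup x l ω = tup x l ω' ↔ Kl x l ω ω' := by
  unfold tup Kl
  constructor
  · intro h i hi
    exact congrFun h ⟨i, hi⟩
  · intro h
    funext i
    exact h i.1 i.2

theorem Kl_append {Ω : Type} {W : ℕ → Type} (x : ∀ i, Ω → W i) (l l' : List ℕ) (ω ω' : Ω) :
    Kl x (l ++ l') ω ω' ↔ Kl x l ω ω' ∧ Kl x l' ω ω' := by
  unfold Kl
  simp only [List.mem_append]
  exact ⟨fun h => ⟨fun i hi => h i (Or.inl hi), fun i hi => h i (Or.inr hi)⟩,
    fun h i hi => hi.elim (h.1 i) (h.2 i)⟩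

section fin
variable {Ω : Type} [Fintype Ω] {p : Ω → ℝ} (hp : ∀ ω, 0 < p ω) (hs : ∑ ω, p ω = 1)
  {W : ℕ → Type} (x : ∀ i, Ω → W i)
include hp hs

theorem ent_append (l l' : List ℕ) : ent p (tup x (l ++ l')) =
    ent p (fun ω => (tup x l ω, tup x l' ω)) := by
  refine ent_congr fun ω ω' => ?_
  rw [tup_eq, Kl_append, Prod.mk.injEq, tup_eq, tup_eq]

theorem cval_nonneg (c : Con) : 0 ≤ cval (fun l => ent p (tup x l)) c := by
  unfold cval
  split_ifs
  · beta_reduce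
    rw [ent_append hp hs]
    exact ent_indep_nonneg hp hs _ _
  · rw [sub_nonneg]
    refine ent_mono hp fun ω ω' h => ?_
    rw [tup_eq, Kl_append] at h
    exact (tup_eq _ _ _ _).2 h.1

theorem sem_of_cval (c : Con) (h : cval (fun l => ent p (tup x l)) c = 0) : Sem x c := by
  unfold cval at h
  unfold Sem
  split_ifs at h ⊢
  · beta_reduce at h
    rw [ent_append hp hs] at h
    intro ω₁ ω₂
    obtain ⟨ω, h1, h2⟩ := prod_of_ent_eq hp hs _ _ h ω₁ ω₂
    exact ⟨ω, (tup_eq _ _ _ _).1 h1, (tup_eq _ _ _ _).1 h2⟩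
  · intro ω ω' hk
    have := func_of_ent_eq hp (f := tup x c.2.1) (h := tup x (c.2.1 ++ c.2.2)) (fun ω ω' h => by
      rw [tup_eq, Kl_append] at h
      exact (tup_eq _ _ _ _).2 h.1) (by linarith) ω ω' ((tup_eq _ _ _ _).2 hk)
    rw [tup_eq, Kl_append] at this
    exact this.2

theorem cval_of_sem_func (c : Con) (hc : c.1 = false) (h : Sem x c) :
    cval (fun l => ent p (tup x l)) c = 0 := by
  unfold Sem at h
  unfold cval
  simp only [hc, Bool.false_eq_true, if_false] at h ⊢
  rw [sub_eq_zero]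
  refine ent_congr fun ω ω' => ?_
  rw [tup_eq, Kl_append, tup_eq]
  exact ⟨fun h => h.1, fun h1 => ⟨h1, h _ _ h1⟩⟩

end fin

theorem relSign_neg (b : Bool) {x : ℝ} (hx : 0 ≤ x) : RelSign b (-x) ↔ x = 0 := by
  unfold RelSign
  split_ifs
  · constructor
    · intro h; linarith
    · rintro rfl; simp
  · simp

theorem sum_zero_iff (f : Con → ℝ) (hf : ∀ c, 0 ≤ f c) (C : List Con) :
    0 ≤ (C.map f).sum ∧ ((C.map f).sum = 0 ↔ ∀ c ∈ C, f c = 0) := by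
  induction C with
  | nil => simp
  | cons c C ih =>
    have := hf c
    refine ⟨by simpa using add_nonneg this ih.1, ?_⟩
    simp only [List.map_cons, List.sum_cons, List.mem_cons, forall_eq_or_imp, ← ih.2]
    constructor
    · intro h
      constructor <;> linarith [ih.1]
    · rintro ⟨h1, h2⟩; rw [h1, h2]; simp

/-- Common reduction: with the entropies of a finite positive space. -/
theorem entCombo_fin {Ω₀ : Type} {p₀ : Ω₀ → ℝ} {V : ℕ → Type} (X : ∀ i, Ω₀ → V i) (k : ℕ)
    {Ω : Type} [Fintype Ω] {p : Ω → ℝ} (hp : ∀ ω, 0 < p ω) (hs : ∑ ω, p ω = 1)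
    {W : ℕ → Type} (x : ∀ i, Ω → W i)
    (hH : ∀ l : List ℕ, (∀ i ∈ l, i < k) → HL p₀ X l = ent p (tup x l))
    (b : Bool) (C : List Con) (hC : ∀ c ∈ C, OKc k c) :
    RelSign b (entCombo p₀ X k (coef k C)) ↔ ∀ c ∈ C, cval (fun l => ent p (tup x l)) c = 0 := by
  rw [entCombo_coef _ _ _ _ hC]
  have : C.map (cval (HL p₀ X)) = C.map (cval (fun l => ent p (tup x l))) := by
    refine List.map_congr_left fun c hc => ?_
    have h4 := (hC c hc).2.2.2
    unfold cval
    rw [hH _ h4, hH _ fun i hi => h4 i (by simp [hi]), hH _ fun i hi => h4 i (by simp [hi])]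
  rw [this]
  have h := sum_zero_iff _ (cval_nonneg hp hs x) C
  rw [relSign_neg b h.1, h.2]

theorem red_sound (k : ℕ) (C : List Con) (D : Con) (hC : ∀ c ∈ C, OKc k c) (hD : OKc k D)
    (hDf : D.1 = false)
    (hmain : ∀ (Ω : Type) (W : ℕ → Type) (x : ∀ i, Ω → W i), Nonempty Ω →
      (∀ c ∈ C, Sem x c) → Sem x D) (b₁ b₂ : Bool) :
    EntHolds b₁ b₂ (k, coef k C, coef k [D]) := by
  intro Ω₀ p₀ hp₀ V X hX
  have hne : ∃ ω, p₀ ω ≠ 0 := by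
    by_contra hcon
    push Not at hcon
    have := isProb_tsum hp₀
    simp [hcon] at this
  obtain ⟨ω₀, hω₀⟩ := hne
  let J : Ω₀ → (∀ i : Fin k, V (i.1 + 1)) := fun ω i => X (i.1 + 1) ω
  let S : Set (∀ i : Fin k, V (i.1 + 1)) := {v | ∃ ω, p₀ ω ≠ 0 ∧ J ω = v}
  have hSfin : S.Finite := by
    refine (Set.Finite.pi' (ι := Fin k) (t := fun i => supp p₀ (X (i.1 + 1)))
      fun i => hX _).subset ?_
    rintro v ⟨ω, h1, rfl⟩ i
    have := le_Pr hp₀ {ω' | X (i.1 + 1) ω' = X (i.1 + 1) ω} ω rfl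
    exact lt_of_lt_of_le (lt_of_le_of_ne (hp₀.1 ω) (Ne.symm h1)) this
  have : Fintype S := hSfin.fintype
  let U : Ω₀ → S := fun ω => if h : p₀ ω ≠ 0 then ⟨J ω, ω, h, rfl⟩ else ⟨J ω₀, ω₀, hω₀, rfl⟩
  have hU : ∀ ω, p₀ ω ≠ 0 → (U ω).1 = J ω := by
    intro ω h
    simp [U, h]
  let r : S → Ω₀ := fun v => v.2.choose
  have hr : ∀ v, p₀ (r v) ≠ 0 ∧ J (r v) = v.1 := fun v => v.2.choose_spec
  let p : S → ℝ := fun t => Pr p₀ {ω | U ω = t}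
  have hp : ∀ t, 0 < p t := by
    intro t
    have := le_Pr hp₀ {ω | U ω = t} (r t) (by
      apply Subtype.ext
      rw [hU _ (hr t).1, (hr t).2])
    exact lt_of_lt_of_le (lt_of_le_of_ne (hp₀.1 _) (Ne.symm (hr t).1)) this
  have hs : ∑ t, p t = 1 := by
    rw [← isProb_tsum hp₀]
    have h1 : ∀ ω, p₀ ω = ∑ t, ({ω | U ω = t} : Set Ω₀).indicator p₀ ω := by
      intro ω
      simp [Set.indicator_apply]
    rw [tsum_congr h1, Summable.tsum_finsetSum]
    · exact Finset.sum_congr rfl fun t _ => Pr_eq_tsum _ _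
    · exact fun t _ => (isProb_summable hp₀).indicator _
  let x : ∀ i, S → V (i + 1) := fun i t => X (i + 1) (r t)
  have hH : ∀ l : List ℕ, (∀ i ∈ l, i < k) → HL p₀ X l = ent p (tup x l) := by
    intro l hl
    unfold HL jointEntropy
    rw [entropy_eq_ent hp₀ U _ (fun t => fun i : {x // x ∈ l.toFinset.image (· + 1)} => X i.1 (r t))]
    · refine ent_congr fun ω ω' => ?_
      rw [tup_eq]
      unfold Kl
      constructor
      · intro h i hi
        exact congrFun h ⟨i + 1, by simp [hi]⟩
      · intro h
        funext ⟨i, hi⟩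
        simp only [Finset.mem_image, List.mem_toFinset] at hi
        obtain ⟨j, hj, rfl⟩ := hi
        exact h j hj
    · intro ω h
      funext ⟨i, hi⟩
      simp only [Finset.mem_image, List.mem_toFinset] at hi
      obtain ⟨j, hj, rfl⟩ := hi
      have : J ω = J (r (U ω)) := by rw [(hr _).2, hU _ h]
      exact congrFun this ⟨j, hl j hj⟩
  intro hA
  rw [entCombo_fin X k hp hs x hH b₁ C hC] at hA
  rw [entCombo_fin X k hp hs x hH b₂ [D] (by simpa using hD)]
  have := hmain S _ x ⟨U ω₀⟩ fun c hc => sem_of_cval hp hs x c (hA c hc)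
  simpa using cval_of_sem_func hp hs x D hDf this

section grp
variable {G : Type} [Fintype G] [AddCommGroup G] {B : Type} [AddCommGroup B]

/-- The uniform weight. -/
def unif (G : Type) [Fintype G] : G → ℝ := fun _ => ((Fintype.card G : ℝ))⁻¹

theorem unif_pos : ∀ ω : G, 0 < unif G ω := by
  intro ω
  unfold unif
  have : 0 < Fintype.card G := Fintype.card_pos_iff.2 ⟨ω⟩
  positivity

theorem unif_sum : ∑ ω, unif G ω = 1 := by
  unfold unif
  have : 0 < Fintype.card G := Fintype.card_pos_iff.2 ⟨0⟩
  simp [this.ne']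

theorem ent_hom (f : G →+ B) : ent (unif G) f = Real.log (Nat.card (Set.range f)) := by
  have hG : 0 < Fintype.card G := Fintype.card_pos_iff.2 ⟨0⟩
  have h1 : ∀ ω, fib (unif G) f ω = (Nat.card f.ker : ℝ) * ((Fintype.card G : ℝ))⁻¹ := by
    intro ω
    unfold fib unif
    rw [← Finset.sum_filter, Finset.sum_const, nsmul_eq_mul]
    congr 2
    rw [← Fintype.card_subtype, ← Nat.card_eq_fintype_card]
    refine Nat.card_congr
      ⟨fun a => ⟨a.1 - ω, by simp [AddMonoidHom.mem_ker, a.2]⟩, fun a => ⟨a.1 + ω, ?_⟩, ?_, ?_⟩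
    · have := a.2
      rw [AddMonoidHom.mem_ker] at this
      simp [this]
    · intro a; simp
    · intro a; simp
  have h2 : Nat.card f.ker * Nat.card (Set.range f) = Fintype.card G := by
    have h3 := AddSubgroup.card_mul_index f.ker
    rw [AddSubgroup.index_ker] at h3
    rw [← Nat.card_eq_fintype_card, ← h3]
    rfl
  have h4 : 0 < Nat.card f.ker := Nat.card_pos
  have h5 : 0 < Nat.card (Set.range f) := by
    rcases Nat.eq_zero_or_pos (Nat.card (Set.range f)) with h | h
    · rw [h] at h2; omega
    · exact h
  unfold ent
  simp only [h1]
  rw [← Finset.sum_mul, unif_sum, one_mul, ← h2]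
  push_cast
  rw [mul_inv, ← mul_assoc, mul_inv_cancel₀ (by positivity), one_mul, Real.log_inv, neg_neg]

theorem indep_hom {B' : Type} [AddCommGroup B'] (f : G →+ B) (g : G →+ B')
    (h : ∀ ω₁ ω₂, ∃ ω, f ω = f ω₁ ∧ g ω = g ω₂) :
    ent (unif G) f + ent (unif G) g - ent (unif G) (fun ω => (f ω, g ω)) = 0 := by
  have h1 := ent_hom (f.prod g)
  have h2 : Set.range (f.prod g) = Set.range f ×ˢ Set.range g := by
    ext ⟨b, c⟩
    constructor
    · rintro ⟨ω, h⟩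
      simp only [AddMonoidHom.prod_apply, Prod.mk.injEq] at h
      exact ⟨⟨ω, h.1⟩, ⟨ω, h.2⟩⟩
    · rintro ⟨⟨ω₁, h1⟩, ⟨ω₂, h2⟩⟩
      obtain ⟨ω, h3, h4⟩ := h ω₁ ω₂
      refine ⟨ω, ?_⟩
      simp only [AddMonoidHom.prod_apply, Prod.mk.injEq]
      exact ⟨h3.trans h1, h4.trans h2⟩
  have h3 : ent (unif G) (fun ω => (f ω, g ω)) = ent (unif G) (f.prod g) := rfl
  have h5 : (Nat.card (Set.range f) : ℝ) ≠ 0 := by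
    have : Nonempty (Set.range f) := ⟨⟨f 0, 0, rfl⟩⟩
    have : Finite (Set.range f) := Set.finite_range f
    exact_mod_cast Nat.card_pos.ne'
  have h6 : (Nat.card (Set.range g) : ℝ) ≠ 0 := by
    have : Nonempty (Set.range g) := ⟨⟨g 0, 0, rfl⟩⟩
    have : Finite (Set.range g) := Set.finite_range g
    exact_mod_cast Nat.card_pos.ne'
  rw [h3, h1, h2, ent_hom, ent_hom, Nat.card_congr (Equiv.Set.prod _ _), Nat.card_prod]
  push_cast
  rw [Real.log_mul h5 h6, sub_self]

/-- The tuple of homomorphisms. -/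
def tupHom (x : ℕ → G →+ B) (l : List ℕ) : G →+ ({i // i ∈ l} → B) :=
  AddMonoidHom.mk' (tup (W := fun _ => B) (fun i => x i) l) (by
    intro a b; funext i; simp [tup])

theorem red_complete (x : ℕ → G →+ B) (k : ℕ) (C : List Con) (D : Con)
    (hC : ∀ c ∈ C, OKc k c) (hD : OKc k D)
    (hCs : ∀ c ∈ C, Sem (W := fun _ => B) (fun i => x i) c)
    (hDs : ¬ Sem (W := fun _ => B) (fun i => x i) D) (b₁ b₂ : Bool) :
    ¬ EntHolds b₁ b₂ (k, coef k C, coef k [D]) := by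
  intro hE
  have hprob : IsProb (unif G) := by
    refine ⟨fun ω => (unif_pos ω).le, ?_⟩
    rw [Pr_eq_tsum, Set.indicator_univ, tsum_fintype, unif_sum]
  let X : ∀ i : ℕ, G → (fun _ : ℕ => B) i := fun i => x (i - 1)
  have hfin : ∀ i, (supp (unif G) (X i)).Finite := by
    intro i
    refine (Set.finite_range (X i)).subset ?_
    intro a ha
    by_contra hcon
    have : {ω | X i ω = a} = ∅ := by
      ext ω
      simp only [Set.mem_ofPred_eq, Set.mem_empty_iff_false, iff_false]
      intro h
      exact hcon ⟨ω, h⟩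
    unfold supp at ha
    rw [Set.mem_ofPred_eq, this, Pr_eq_tsum] at ha
    simp at ha
  have hPr : (fun t => Pr (unif G) {ω | id ω = t}) = unif G := by
    funext t
    rw [Pr_eq_tsum, tsum_eq_single t]
    · simp
    · intro b hb
      simp [hb]
  have hH : ∀ l : List ℕ, (∀ i ∈ l, i < k) →
      HL (unif G) X l = ent (unif G) (tup (W := fun _ => B) (fun i => x i) l) := by
    intro l _
    unfold HL jointEntropy
    rw [entropy_eq_ent hprob id
      (fun t => fun i : {x // x ∈ l.toFinset.image (· + 1)} => X i.1 t)
      (fun t => fun i : {x // x ∈ l.toFinset.image (· + 1)} => X i.1 t) (fun _ _ => rfl), hPr]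
    refine ent_congr fun ω ω' => ?_
    rw [tup_eq]
    unfold Kl
    constructor
    · intro h i hi
      have := congrFun h ⟨i + 1, by simp [hi]⟩
      simpa [X] using this
    · intro h
      funext ⟨i, hi⟩
      simp only [Finset.mem_image, List.mem_toFinset] at hi
      obtain ⟨j, hj, rfl⟩ := hi
      simpa [X] using h j hj
  have h := hE G (unif G) hprob (fun _ => B) X hfin
  rw [entCombo_fin X k unif_pos unif_sum _ hH b₁ C hC,
    entCombo_fin X k unif_pos unif_sum _ hH b₂ [D] (by simpa using hD)] at h
  refine hDs (sem_of_cval unif_pos unif_sum _ D (h ?_ D (by simp)))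
  intro c hc
  cases hb : c.1
  · exact cval_of_sem_func unif_pos unif_sum _ c hb (hCs c hc)
  · have hsem := hCs c hc
    unfold Sem at hsem
    unfold cval
    simp only [hb, if_true] at hsem ⊢
    rw [ent_append unif_pos unif_sum]
    refine indep_hom (tupHom x c.2.1) (tupHom x c.2.2) fun ω₁ ω₂ => ?_
    obtain ⟨ω, h1, h2⟩ := hsem ω₁ ω₂
    exact ⟨ω, (tup_eq _ _ _ _).2 h1, (tup_eq _ _ _ _).2 h2⟩

end grp

end UndecCII
end

open scoped Classical
noncomputable section

namespace UndecCII

/-- Position of the variable `Q_{a,τ}`. -/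
def qp (a τ : ℕ) : ℕ := 3 + 3 * a + τ

def genCons (a : ℕ) : List Con :=
  [(true, [0], [qp a 0]), (false, [0, qp a 0], [1]), (false, [0, 1], [qp a 0]),
   (true, [1], [qp a 1]), (false, [1, qp a 1], [2]), (false, [1, 2], [qp a 1]),
   (true, [0], [qp a 2]), (false, [0, qp a 2], [2]), (false, [0, 2], [qp a 2])]

def triCons (t : ℕ × ℕ × ℕ) : List Con :=
  [(true, [0], [qp t.1 0, qp t.2.1 1]), (false, [qp t.1 0, qp t.2.1 1], [qp t.2.2 2])]

def unitCons : List Con := [(true, [1], [qp 0 0]), (false, [2, qp 0 1], [1])]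

def allCons (g : ℕ) (T : List (ℕ × ℕ × ℕ)) : List Con :=
  (List.range g).flatMap genCons ++ (T.flatMap triCons ++ unitCons)

def concl (s t : ℕ) : Con := (false, [qp s 2], [qp t 2])

theorem ok_allCons (g : ℕ) (hg : 0 < g) (T : List (ℕ × ℕ × ℕ))
    (hT : ∀ t ∈ T, t.1 < g ∧ t.2.1 < g ∧ t.2.2 < g) :
    ∀ c ∈ allCons g T, OKc (3 + 3 * g) c := by
  intro c hc
  unfold allCons at hc
  simp only [List.mem_append, List.mem_flatMap, List.mem_range] at hc
  rcases hc with ⟨a, ha, hc⟩ | ⟨t, ht, hc⟩ | hc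
  · simp only [genCons, List.mem_cons, List.not_mem_nil, or_false] at hc
    rcases hc with rfl | rfl | rfl | rfl | rfl | rfl | rfl | rfl | rfl <;>
      simp [OKc, qp] <;> omega
  · obtain ⟨h1, h2, h3⟩ := hT t ht
    simp only [triCons, List.mem_cons, List.not_mem_nil, or_false] at hc
    rcases hc with rfl | rfl <;> simp [OKc, qp] <;> omega
  · simp only [unitCons, List.mem_cons, List.not_mem_nil, or_false] at hc
    rcases hc with rfl | rfl <;> simp [OKc, qp] <;> omega

theorem ok_concl (g s t : ℕ) (hs : s < g) (ht : t < g) (hst : s ≠ t) :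
    OKc (3 + 3 * g) (concl s t) := by
  simp [OKc, concl, qp]
  omega

section sound
variable {Ω : Type}

theorem sem_map {A B D : Type} (X : Ω → A) (Y : Ω → B) (Q : Ω → D) (w : Ω)
    (h1 : ∀ ω₁ ω₂, ∃ ω, X ω = X ω₁ ∧ Q ω = Q ω₂)
    (h2 : ∀ ω ω', X ω = X ω' → Q ω = Q ω' → Y ω = Y ω')
    (h3 : ∀ ω ω', X ω = X ω' → Y ω = Y ω' → Q ω = Q ω') :
    ∃ f : Set.range X → Set.range Y, ∀ ω,
      Q ω = Q w ↔ Set.rangeFactorization Y ω = f (Set.rangeFactorization X ω) := by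
  have h4 : ∀ a : Set.range X, ∃ ω, X ω = a.1 ∧ Q ω = Q w := by
    rintro ⟨_, ω, rfl⟩
    exact h1 ω w
  choose r hr using h4
  refine ⟨fun a => ⟨Y (r a), r a, rfl⟩, fun ω => ?_⟩
  have hr' := hr (Set.rangeFactorization X ω)
  have e1 : X (r (Set.rangeFactorization X ω)) = X ω := hr'.1
  constructor
  · intro h
    apply Subtype.ext
    exact h2 _ _ e1.symm (h.trans hr'.2.symm)
  · intro h
    have : Y ω = Y (r (Set.rangeFactorization X ω)) := congrArg Subtype.val h
    rw [← hr'.2]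
    exact h3 _ _ e1.symm this

theorem comb_sound (g : ℕ) (hg : 0 < g) (T : List (ℕ × ℕ × ℕ)) (s t : ℕ) (hs : s < g) (ht : t < g)
    (hT : ∀ t ∈ T, t.1 < g ∧ t.2.1 < g ∧ t.2.2 < g)
    (hT1 : ∀ a < g, (0, a, a) ∈ T ∧ (a, 0, a) ∈ T)
    (hcore : ∀ (P : Type) (F : ℕ → P → P), IsModel T F → F s = F t)
    (W : ℕ → Type) (x : ∀ i, Ω → W i) (hsem : ∀ c ∈ allCons g T, Sem x c) :
    Sem x (concl s t) := by
  have hgen : ∀ a < g, ∀ c ∈ genCons a, Sem x c := by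
    intro a ha c hc
    refine hsem c ?_
    unfold allCons
    rw [List.mem_append, List.mem_flatMap]
    exact Or.inl ⟨a, by simpa using ha, hc⟩
  have htri : ∀ a ∈ T, ∀ c ∈ triCons a, Sem x c := by
    intro a ha c hc
    refine hsem c ?_
    unfold allCons
    rw [List.mem_append, List.mem_append]
    exact Or.inr (Or.inl (List.mem_flatMap.2 ⟨a, ha, hc⟩))
  have hunit : ∀ c ∈ unitCons, Sem x c := by
    intro c hc
    refine hsem c ?_
    unfold allCons
    simp [hc]
  clear hsem
  simp only [genCons, List.forall_mem_cons, Sem, Kl, List.not_mem_nil, false_imp_iff,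
    implies_true, and_true, if_true, Bool.false_eq_true, if_false, and_imp] at hgen
  simp only [triCons, List.forall_mem_cons, Sem, Kl, List.not_mem_nil, false_imp_iff,
    implies_true, and_true, if_true, Bool.false_eq_true, if_false, and_imp] at htri
  simp only [unitCons, List.forall_mem_cons, Sem, Kl, List.not_mem_nil, false_imp_iff,
    implies_true, and_true, if_true, Bool.false_eq_true, if_false, and_imp] at hunit
  simp only [concl, List.forall_mem_cons, Sem, Kl, List.not_mem_nil, false_imp_iff,
    implies_true, and_true, if_true, Bool.false_eq_true, if_false, and_imp]
  intro w w' hw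
  let A := Set.range (x 0)
  let B := Set.range (x 1)
  let D := Set.range (x 2)
  let X : Ω → A := Set.rangeFactorization (x 0)
  let Y : Ω → B := Set.rangeFactorization (x 1)
  let Z : Ω → D := Set.rangeFactorization (x 2)
  have hXe : ∀ ω ω', x 0 ω = x 0 ω' → X ω = X ω' := fun ω ω' h => Subtype.ext h
  have hYe : ∀ ω ω', x 1 ω = x 1 ω' → Y ω = Y ω' := fun ω ω' h => Subtype.ext h
  have e1 : ∀ a, ∃ f : A → B, a < g → ∀ ω, x (qp a 0) ω = x (qp a 0) w ↔ Y ω = f (X ω) := by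
    intro a
    by_cases ha : a < g
    · obtain ⟨h1, h2, h3, h4, h5, h6, h7, h8, h9⟩ := hgen a ha
      obtain ⟨f, hf⟩ := sem_map (x 0) (x 1) (x (qp a 0)) w h1 h2 h3
      exact ⟨f, fun _ => hf⟩
    · exact ⟨fun _ => Y w, fun h => absurd h ha⟩
  have e2 : ∀ a, ∃ f : B → D, a < g → ∀ ω, x (qp a 1) ω = x (qp a 1) w ↔ Z ω = f (Y ω) := by
    intro a
    by_cases ha : a < g
    · obtain ⟨h1, h2, h3, h4, h5, h6, h7, h8, h9⟩ := hgen a ha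
      obtain ⟨f, hf⟩ := sem_map (x 1) (x 2) (x (qp a 1)) w h4 h5 h6
      exact ⟨f, fun _ => hf⟩
    · exact ⟨fun _ => Z w, fun h => absurd h ha⟩
  have e3 : ∀ a, ∃ f : A → D, a < g → ∀ ω, x (qp a 2) ω = x (qp a 2) w ↔ Z ω = f (X ω) := by
    intro a
    by_cases ha : a < g
    · obtain ⟨h1, h2, h3, h4, h5, h6, h7, h8, h9⟩ := hgen a ha
      obtain ⟨f, hf⟩ := sem_map (x 0) (x 2) (x (qp a 2)) w h7 h8 h9
      exact ⟨f, fun _ => hf⟩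
    · exact ⟨fun _ => Z w, fun h => absurd h ha⟩
  choose f1 hf1 using e1
  choose f2 hf2 using e2
  choose f3 hf3 using e3
  have comp : ∀ a b c, (a, b, c) ∈ T → ∀ y, f3 c y = f2 b (f1 a y) := by
    intro a b c habc y
    obtain ⟨ha, hb, hc⟩ := hT _ habc
    obtain ⟨h1, h2⟩ := htri _ habc
    obtain ⟨_, ω₁, rfl⟩ := y
    obtain ⟨ω, k1, k2, k3⟩ := h1 ω₁ w
    have k4 := h2 _ _ k2 k3
    have m1 := (hf1 a ha ω).1 k2
    have m2 := (hf2 b hb ω).1 k3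
    have m3 := (hf3 c hc ω).1 k4
    rw [m2, m1, hXe _ _ k1] at m3
    exact m3.symm
  -- the unit maps
  have hsurj : Function.Surjective (f1 0) := by
    rintro ⟨_, ω₁, rfl⟩
    obtain ⟨ω, k1, k2⟩ := hunit.1 ω₁ w
    refine ⟨X ω, ?_⟩
    rw [← (hf1 0 hg ω).1 k2]
    exact hYe _ _ k1
  have hinj : Function.Injective (f2 0) := by
    obtain ⟨h1, h2, h3, h4, h5, h6, h7, h8, h9⟩ := hgen 0 hg
    rintro ⟨_, ω₁, rfl⟩ ⟨_, ω₂, rfl⟩ h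
    obtain ⟨ω, k1, k2⟩ := h4 ω₁ w
    obtain ⟨ω', k1', k2'⟩ := h4 ω₂ w
    have m1 := (hf2 0 hg ω).1 k2
    have m2 := (hf2 0 hg ω').1 k2'
    rw [hYe _ _ k1] at m1
    rw [hYe _ _ k1'] at m2
    have : Z ω = Z ω' := by rw [m1, m2]; exact h
    have h7 := hunit.2 ω ω' (congrArg Subtype.val this) (k2.trans k2'.symm)
    apply Subtype.ext
    change x 1 ω₁ = x 1 ω₂
    rw [← k1, ← k1', h7]
  obtain ⟨σ, hσ⟩ := hsurj.hasRightInverse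
  have u1 : ∀ a < g, ∀ y, f3 a y = f2 a (f1 0 y) := fun a ha => comp _ _ _ (hT1 a ha).1
  have u2 : ∀ a < g, ∀ y, f3 a y = f2 0 (f1 a y) := fun a ha => comp _ _ _ (hT1 a ha).2
  have hF := hcore B (fun a y => f1 a (σ y)) (by
    refine ⟨?_, ?_⟩
    · funext y
      exact hσ y
    · rintro ⟨a, b, c⟩ habc
      obtain ⟨ha, hb, hc⟩ := hT _ habc
      funext y
      apply hinj
      change f2 0 (f1 c (σ y)) = f2 0 (f1 b (σ (f1 a (σ y))))
      rw [← u2 c hc, comp _ _ _ habc, ← u2 b hb, u1 b hb, hσ])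
  have hst : ∀ y, f2 s y = f2 t y := by
    intro y
    have : f1 s (σ y) = f1 t (σ y) := congrFun hF y
    rw [← hσ y, ← u1 s hs, ← u1 t ht, u2 s hs, u2 t ht, this]
  have m1 := (hf3 s hs w').1 hw.symm
  rw [u1 s hs, hst, ← u1 t ht] at m1
  exact ((hf3 t ht w').2 m1).symm

end sound

section complete
variable {P : Type}

abbrev VV (P : Type) : Type := P →₀ ZMod 2

def psh (f : P → P) : VV P →+ VV P := Finsupp.mapDomain.addMonoidHom f

theorem psh_id : psh (id : P → P) = AddMonoidHom.id _ := Finsupp.mapDomain.addMonoidHom_id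

theorem psh_comp (f h : P → P) : psh (f ∘ h) = (psh f).comp (psh h) :=
  Finsupp.mapDomain.addMonoidHom_comp f h

theorem psh_inj {f h : P → P} (e : psh f = psh h) : f = h := by
  funext a
  have := DFunLike.congr_fun e (Finsupp.single a 1)
  simp only [psh, Finsupp.mapDomain.addMonoidHom, AddMonoidHom.coe_mk, ZeroHom.coe_mk,
    Finsupp.mapDomain_single] at this
  exact Finsupp.single_left_injective one_ne_zero this

/-- The variables of the linear model. -/
def lin (A : ℕ → VV P →+ VV P) : ℕ → (VV P × VV P × VV P) →+ VV P
  | 0 => AddMonoidHom.fst _ _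
  | 1 => (AddMonoidHom.fst _ _).comp (AddMonoidHom.snd _ _)
  | 2 => (AddMonoidHom.snd _ _).comp (AddMonoidHom.snd _ _)
  | (j + 3) =>
    if j % 3 = 0 then lin A 1 - (A (j / 3)).comp (lin A 0)
    else if j % 3 = 1 then lin A 2 - (A (j / 3)).comp (lin A 1)
    else lin A 2 - (A (j / 3)).comp (lin A 0)

theorem lin_q0 (A : ℕ → VV P →+ VV P) (a : ℕ) (ω) : lin A (qp a 0) ω = ω.2.1 - A a ω.1 := by
  have h : qp a 0 = 3 * a + 3 := by unfold qp; omega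
  have h1 : 3 * a % 3 = 0 := by omega
  have h2 : 3 * a / 3 = a := by omega
  rw [h, lin, if_pos h1, h2]
  simp [lin]

theorem lin_q1 (A : ℕ → VV P →+ VV P) (a : ℕ) (ω) : lin A (qp a 1) ω = ω.2.2 - A a ω.2.1 := by
  have h : qp a 1 = (3 * a + 1) + 3 := by unfold qp; omega
  have h1 : ¬ (3 * a + 1) % 3 = 0 := by omega
  have h1' : (3 * a + 1) % 3 = 1 := by omega
  have h2 : (3 * a + 1) / 3 = a := by omega
  rw [h, lin, if_neg h1, if_pos h1', h2]
  simp [lin]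

theorem lin_q2 (A : ℕ → VV P →+ VV P) (a : ℕ) (ω) : lin A (qp a 2) ω = ω.2.2 - A a ω.1 := by
  have h : qp a 2 = (3 * a + 2) + 3 := by unfold qp; omega
  have h1 : ¬ (3 * a + 2) % 3 = 0 := by omega
  have h1' : ¬ (3 * a + 2) % 3 = 1 := by omega
  have h2 : (3 * a + 2) / 3 = a := by omega
  rw [h, lin, if_neg h1, if_neg h1', h2]
  simp [lin]

theorem comb_complete (g : ℕ) (T : List (ℕ × ℕ × ℕ)) (s t : ℕ)
    (F : ℕ → P → P) (hF : IsModel T F) (hne : F s ≠ F t) :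
    (∀ c ∈ allCons g T,
      Sem (W := fun _ => VV P) (fun i => lin (fun a => psh (F a)) i) c) ∧
    ¬ Sem (W := fun _ => VV P) (fun i => lin (fun a => psh (F a)) i) (concl s t) := by
  set A : ℕ → VV P →+ VV P := fun a => psh (F a) with hA
  have hA0 : ∀ y, A 0 y = y := by
    intro y
    simp only [hA, hF.1, psh_id, AddMonoidHom.id_apply]
  have l0 : ∀ ω, lin A 0 ω = ω.1 := fun ω => by simp [lin]
  have l1 : ∀ ω, lin A 1 ω = ω.2.1 := fun ω => by simp [lin]
  have l2 : ∀ ω, lin A 2 ω = ω.2.2 := fun ω => by simp [lin]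
  constructor
  · intro c hc
    unfold allCons at hc
    simp only [List.mem_append, List.mem_flatMap, List.mem_range] at hc
    rcases hc with ⟨a, ha, hc⟩ | ⟨⟨a, b, d⟩, ht, hc⟩ | hc
    · simp only [genCons, List.mem_cons, List.not_mem_nil, or_false] at hc
      rcases hc with rfl | rfl | rfl | rfl | rfl | rfl | rfl | rfl | rfl <;>
        simp only [List.forall_mem_cons, Sem, Kl, List.not_mem_nil, false_imp_iff,
          implies_true, and_true, if_true, Bool.false_eq_true, if_false, and_imp,
          l0, l1, l2, lin_q0, lin_q1, lin_q2, Prod.forall, Prod.exists]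
      · intro x y z x' y' z'
        exact ⟨x, y' - A a x' + A a x, 0, rfl, by abel⟩
      · rintro x y z x' y' z' rfl h
        simpa using h
      · rintro x y z x' y' z' rfl rfl; rfl
      · intro x y z x' y' z'
        exact ⟨0, y, z' - A a y' + A a y, rfl, by abel⟩
      · rintro x y z x' y' z' rfl h
        simpa using h
      · rintro x y z x' y' z' rfl rfl; rfl
      · intro x y z x' y' z'
        exact ⟨x, 0, z' - A a x' + A a x, rfl, by abel⟩
      · rintro x y z x' y' z' rfl h
        simpa using h
      · rintro x y z x' y' z' rfl rfl; rfl
    · have hd : ∀ y, A d y = A b (A a y) := by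
        intro y
        have : F d = F b ∘ F a := hF.2 _ ht
        simp only [hA, this, psh_comp, AddMonoidHom.comp_apply]
      simp only [triCons, List.mem_cons, List.not_mem_nil, or_false] at hc
      rcases hc with rfl | rfl <;>
        simp only [List.forall_mem_cons, Sem, Kl, List.not_mem_nil, false_imp_iff,
          implies_true, and_true, if_true, Bool.false_eq_true, if_false, and_imp,
          l0, l1, l2, lin_q0, lin_q1, lin_q2, Prod.forall, Prod.exists]
      · intro x y z x' y' z'
        exact ⟨x, y' - A a x' + A a x, z' - A b y' + A b (y' - A a x' + A a x), rfl,
          by abel, by abel⟩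
      · intro x y z x' y' z' h1 h2
        have e : ∀ x y z, z - A d x = (z - A b y) + A b (y - A a x) := by
          intro x y z
          rw [hd, map_sub]; abel
        rw [e x y z, e x' y' z', h1, h2]
    · simp only [unitCons, List.mem_cons, List.not_mem_nil, or_false] at hc
      rcases hc with rfl | rfl <;>
        simp only [List.forall_mem_cons, Sem, Kl, List.not_mem_nil, false_imp_iff,
          implies_true, and_true, if_true, Bool.false_eq_true, if_false, and_imp,
          l0, l1, l2, lin_q0, lin_q1, lin_q2, Prod.forall, Prod.exists, hA0]
      · intro x y z x' y' z'
        exact ⟨y - (y' - x'), y, 0, rfl, by abel⟩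
      · rintro x y z x' y' z' rfl h
        simpa using h
  · intro h
    simp only [concl, List.forall_mem_cons, Sem, Kl, List.not_mem_nil, false_imp_iff,
      implies_true, and_true, if_true, Bool.false_eq_true, if_false, and_imp,
      l0, l1, l2, lin_q0, lin_q1, lin_q2, Prod.forall, Prod.exists] at h
    apply hne
    apply psh_inj
    refine DFunLike.ext _ _ fun y => ?_
    have := h y 0 (A s y) 0 0 0 (by simp)
    simp only [map_zero, sub_zero, sub_eq_zero] at this
    exact this

end complete

end UndecCII
end

open scoped Classical
noncomputable section

namespace UndecCII
open Encodable

theorem int_encode (z : ℤ) : (encode z + 1) / 2 = z.natAbs := by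
  have : encode z = Equiv.intEquivNat z := rfl
  rw [this]
  cases z with
  | ofNat n =>
    have : Equiv.intEquivNat (Int.ofNat n) = 2 * n := rfl
    rw [this]; simp; omega
  | negSucc n =>
    have : Equiv.intEquivNat (Int.negSucc n) = 2 * n + 1 := rfl
    rw [this]; simp; omega

theorem int_encode_sub (a b : ℕ) :
    encode ((a : ℤ) - b) = if b ≤ a then 2 * (a - b) else 2 * (b - a) - 1 := by
  split_ifs with h
  · have : (a : ℤ) - b = Int.ofNat (a - b) := by simp; omega
    rw [this]; rfl
  · have : (a : ℤ) - b = Int.negSucc (b - a - 1) := by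
      rw [Int.negSucc_eq]; omega
    rw [this]
    have : encode (Int.negSucc (b - a - 1)) = 2 * (b - a - 1) + 1 := rfl
    rw [this]; omega

theorem rat_encode (q : ℚ) : @encode ℚ Rat.instEncodable q = Nat.pair (encode q.num) q.den := rfl

/-- Codes of rationals. -/
def ratCode (m : ℕ) : Prop :=
  0 < m.unpair.2 ∧ ∀ d < m.unpair.2 + 1, ¬ (d ≠ 1 ∧ (m.unpair.1 + 1) / 2 % d = 0 ∧ m.unpair.2 % d = 0)

theorem mem_range_rat (m : ℕ) : m ∈ Set.range (@encode ℚ Rat.instEncodable) ↔ ratCode m := by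
  have key : ∀ a b : ℕ, 0 < b → ((∀ d < b + 1, ¬ (d ≠ 1 ∧ a % d = 0 ∧ b % d = 0)) ↔
      Nat.Coprime a b) := by
    intro a b hb
    constructor
    · intro h
      by_contra hc
      refine h (Nat.gcd a b) (Nat.lt_succ_of_le (Nat.gcd_le_right _ hb)) ⟨hc, ?_, ?_⟩
      · exact Nat.mod_eq_zero_of_dvd (Nat.gcd_dvd_left _ _)
      · exact Nat.mod_eq_zero_of_dvd (Nat.gcd_dvd_right _ _)
    · rintro h d _ ⟨h1, h2, h3⟩
      have := Nat.dvd_gcd (Nat.dvd_of_mod_eq_zero h2) (Nat.dvd_of_mod_eq_zero h3)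
      rw [h] at this
      exact h1 (Nat.dvd_one.1 this)
  constructor
  · rintro ⟨q, rfl⟩
    unfold ratCode
    rw [rat_encode, Nat.unpair_pair]
    dsimp only
    refine ⟨q.den_pos, ?_⟩
    rw [key _ _ q.den_pos, int_encode]
    exact q.reduced
  · rintro ⟨h1, h2⟩
    rw [key _ _ h1] at h2
    obtain ⟨z, hz⟩ := Equiv.intEquivNat.surjective m.unpair.1
    have hz' : encode z = m.unpair.1 := hz
    rw [← hz', int_encode] at h2
    refine ⟨⟨z, m.unpair.2, h1.ne', h2⟩, ?_⟩
    rw [rat_encode]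
    dsimp only
    rw [hz', Nat.pair_unpair]

theorem ratCode_prim : PrimrecPred ratCode := by
  have h1 : PrimrecRel (fun (d : ℕ) (m : ℕ) =>
      ¬ (d ≠ 1 ∧ (m.unpair.1 + 1) / 2 % d = 0 ∧ m.unpair.2 % d = 0)) := by
    refine PrimrecPred.not (PrimrecPred.and (PrimrecPred.not ?_) (PrimrecPred.and ?_ ?_))
    · exact Primrec.eq.comp Primrec.fst (Primrec.const 1)
    · refine Primrec.eq.comp (Primrec.nat_mod.comp (Primrec.nat_div.comp (Primrec.succ.comp
        (Primrec.fst.comp (Primrec.unpair.comp Primrec.snd))) (Primrec.const 2)) Primrec.fst)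
        (Primrec.const 0)
    · exact Primrec.eq.comp (Primrec.nat_mod.comp (Primrec.snd.comp
        (Primrec.unpair.comp Primrec.snd)) Primrec.fst) (Primrec.const 0)
  have h2 := h1.forall_lt
  refine PrimrecPred.and ?_ ?_
  · exact Primrec.nat_lt.comp (Primrec.const 0) (Primrec.snd.comp Primrec.unpair)
  · exact h2.comp (Primrec.succ.comp (Primrec.snd.comp Primrec.unpair)) Primrec.id

theorem prim_rat_sub : Primrec (fun x : ℕ × ℕ => ((x.1 : ℚ) - (x.2 : ℚ))) := by
  rw [← Primrec.encode_iff]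
  have h1 : ∀ q : ℚ, @encode ℚ (Primcodable.toEncodable) q =
      ((List.range (@encode ℚ Rat.instEncodable q)).filter (fun m => decide (ratCode m))).length := by
    intro q
    have h : @encode ℚ (Primcodable.toEncodable) q = @List.countP ℕ
      (fun m => @decide (m ∈ Set.range (@encode ℚ Rat.instEncodable))
        (@decidableRangeEncode ℚ Rat.instEncodable m))
        (List.range (@encode ℚ Rat.instEncodable q)) := rfl
    rw [h, List.countP_eq_length_filter]
    congr 2
    funext m
    exact decide_eq_decide.2 (mem_range_rat m)
  have h2 : Primrec (fun x : ℕ × ℕ => @encode ℚ Rat.instEncodable ((x.1 : ℚ) - (x.2 : ℚ))) := by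
    have h3 : ∀ x : ℕ × ℕ, Nat.pair (if x.2 ≤ x.1 then 2 * (x.1 - x.2) else 2 * (x.2 - x.1) - 1) 1 =
        @encode ℚ Rat.instEncodable ((x.1 : ℚ) - (x.2 : ℚ)) := by
      intro x
      have : ((x.1 : ℚ) - (x.2 : ℚ)) = (((x.1 : ℤ) - (x.2 : ℤ) : ℤ) : ℚ) := by push_cast; rfl
      rw [rat_encode, this, Rat.num_intCast, Rat.den_intCast, int_encode_sub]
    refine Primrec.of_eq ?_ h3
    refine Primrec₂.natPair.comp (Primrec.ite (Primrec.nat_le.comp Primrec.snd Primrec.fst) ?_ ?_)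
      (Primrec.const 1)
    · exact Primrec.nat_mul.comp (Primrec.const 2) (Primrec.nat_sub.comp Primrec.fst Primrec.snd)
    · exact Primrec.nat_sub.comp (Primrec.nat_mul.comp (Primrec.const 2)
        (Primrec.nat_sub.comp Primrec.snd Primrec.fst)) (Primrec.const 1)
  refine Primrec.of_eq ?_ fun x => (h1 _).symm
  exact Primrec.list_length.comp ((Primrec.listFilter ratCode_prim).comp
    (Primrec.list_range.comp h2))

theorem prim_count {α : Type} [Primcodable α] {f : α → List ℕ} {g : α → ℕ} (hf : Primrec f)
    (hg : Primrec g) : Primrec (fun a => (f a).count (g a)) := by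
  have h1 : PrimrecRel (fun (x y : ℕ) => x = y) := Primrec.eq
  have h2 := Primrec.list_length.comp ((PrimrecRel.listFilter h1).comp hf hg)
  refine h2.of_eq fun a => ?_
  rw [List.count, List.countP_eq_length_filter]
  congr 2

end UndecCII
end

open scoped Classical
noncomputable section

namespace UndecCII

section prim
variable {α : Type} [Primcodable α]

theorem prim_mask : Primrec mask := by
  have h1 : Primrec (fun l : List ℕ => l.map (fun i => 2 ^ i)) :=
    Primrec.list_map Primrec.id (pow2_prim.comp Primrec.snd).to₂
  have h2 : Primrec (fun l : List ℕ => l.foldr (fun a b => a + b) 0) :=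
    Primrec.list_foldr Primrec.id (Primrec.const 0)
      (Primrec.nat_add.comp (Primrec.fst.comp Primrec.snd) (Primrec.snd.comp Primrec.snd)).to₂
  exact (h2.comp h1).of_eq fun l => rfl

theorem prim_l1 {β : Type} [Primcodable β] {f : α → β} (hf : Primrec f) :
    Primrec (fun a => [f a]) :=
  Primrec.list_cons.comp hf (Primrec.const [])

theorem prim_l2 {β : Type} [Primcodable β] {f f' : α → β} (hf : Primrec f) (hf' : Primrec f') :
    Primrec (fun a => [f a, f' a]) :=
  Primrec.list_cons.comp hf (prim_l1 hf')

theorem prim_posM : Primrec posM := by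
  have m1 : Primrec (fun c : Con => mask c.2.1) :=
    prim_mask.comp (Primrec.fst.comp Primrec.snd)
  have m2 : Primrec (fun c : Con => mask c.2.2) :=
    prim_mask.comp (Primrec.snd.comp Primrec.snd)
  exact Primrec.cond Primrec.fst (prim_l2 m1 m2) (prim_l1 (Primrec.nat_add.comp m1 m2))

theorem prim_negM : Primrec negM := by
  have m1 : Primrec (fun c : Con => mask c.2.1) :=
    prim_mask.comp (Primrec.fst.comp Primrec.snd)
  have m2 : Primrec (fun c : Con => mask c.2.2) :=
    prim_mask.comp (Primrec.snd.comp Primrec.snd)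
  exact Primrec.cond Primrec.fst (prim_l1 (Primrec.nat_add.comp m1 m2)) (prim_l1 m1)

theorem prim_coef {k : α → ℕ} {C : α → List Con} (hk : Primrec k) (hC : Primrec C) :
    Primrec (fun a => coef (k a) (C a)) := by
  have h1 : Primrec (fun a => List.range (2 ^ k a - 1)) :=
    Primrec.list_range.comp (Primrec.nat_sub.comp (pow2_prim.comp hk) (Primrec.const 1))
  have hn : Primrec (fun a => (C a).flatMap negM) :=
    Primrec.list_flatMap hC (prim_negM.comp Primrec.snd).to₂
  have hp : Primrec (fun a => (C a).flatMap posM) :=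
    Primrec.list_flatMap hC (prim_posM.comp Primrec.snd).to₂
  have hn' : Primrec (fun x : α × ℕ => ((C x.1).flatMap negM).count (x.2 + 1)) :=
    prim_count (hn.comp Primrec.fst) (Primrec.succ.comp Primrec.snd)
  have hp' : Primrec (fun x : α × ℕ => ((C x.1).flatMap posM).count (x.2 + 1)) :=
    prim_count (hp.comp Primrec.fst) (Primrec.succ.comp Primrec.snd)
  exact Primrec.list_map h1 (prim_rat_sub.comp (hn'.pair hp')).to₂

theorem prim_qp {f : α → ℕ} (hf : Primrec f) (τ : ℕ) : Primrec (fun a => qp (f a) τ) :=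
  Primrec.nat_add.comp (Primrec.nat_add.comp (Primrec.const 3)
    (Primrec.nat_mul.comp (Primrec.const 3) hf)) (Primrec.const τ)

theorem prim_con (b : Bool) {f g : α → List ℕ} (hf : Primrec f) (hg : Primrec g) :
    Primrec (fun a => ((b, f a, g a) : Con)) :=
  (Primrec.const b).pair (hf.pair hg)

theorem prim_genCons : Primrec genCons := by
  have q := fun τ => prim_qp (Primrec.id (α := ℕ)) τ
  have c := fun i : ℕ => (Primrec.const i : Primrec (fun _ : ℕ => i))
  unfold genCons
  exact Primrec.list_cons.comp (prim_con _ (prim_l1 (c 0)) (prim_l1 (q 0))) <|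
    Primrec.list_cons.comp (prim_con _ (prim_l2 (c 0) (q 0)) (prim_l1 (c 1))) <|
    Primrec.list_cons.comp (prim_con _ (prim_l2 (c 0) (c 1)) (prim_l1 (q 0))) <|
    Primrec.list_cons.comp (prim_con _ (prim_l1 (c 1)) (prim_l1 (q 1))) <|
    Primrec.list_cons.comp (prim_con _ (prim_l2 (c 1) (q 1)) (prim_l1 (c 2))) <|
    Primrec.list_cons.comp (prim_con _ (prim_l2 (c 1) (c 2)) (prim_l1 (q 1))) <|
    Primrec.list_cons.comp (prim_con _ (prim_l1 (c 0)) (prim_l1 (q 2))) <|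
    Primrec.list_cons.comp (prim_con _ (prim_l2 (c 0) (q 2)) (prim_l1 (c 2))) <|
    Primrec.list_cons.comp (prim_con _ (prim_l2 (c 0) (c 2)) (prim_l1 (q 2))) <|
    Primrec.const []

theorem prim_triCons : Primrec triCons := by
  have q1 := fun τ => prim_qp (Primrec.fst (α := ℕ) (β := ℕ × ℕ)) τ
  have q2 := fun τ => prim_qp ((Primrec.fst (α := ℕ) (β := ℕ)).comp
    (Primrec.snd (α := ℕ) (β := ℕ × ℕ))) τ
  have q3 := fun τ => prim_qp ((Primrec.snd (α := ℕ) (β := ℕ)).comp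
    (Primrec.snd (α := ℕ) (β := ℕ × ℕ))) τ
  unfold triCons
  exact Primrec.list_cons.comp
    (prim_con _ (prim_l1 (Primrec.const 0)) (prim_l2 (q1 0) (q2 1))) <|
    Primrec.list_cons.comp (prim_con _ (prim_l2 (q1 0) (q2 1)) (prim_l1 (q3 2))) <|
    Primrec.const []

theorem prim_allCons {g : α → ℕ} {T : α → List (ℕ × ℕ × ℕ)} (hg : Primrec g) (hT : Primrec T) :
    Primrec (fun a => allCons (g a) (T a)) :=
  Primrec.list_append.comp
    (Primrec.list_flatMap (Primrec.list_range.comp hg) (prim_genCons.comp Primrec.snd).to₂)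
    (Primrec.list_append.comp
      (Primrec.list_flatMap hT (prim_triCons.comp Primrec.snd).to₂) (Primrec.const unitCons))

end prim

/-- Triples of the `n`-th instance. -/
def triples (N : ℕ) (R : List (ℕ × ℕ × ℕ)) (u c v n : ℕ) : List (ℕ × ℕ × ℕ) :=
  R ++ ((List.range (N + n + 2)).map (fun a => (0, a, a)) ++
    ((List.range (N + n + 2)).map (fun a => (a, 0, a)) ++
    ((List.range n).map (fun i => (N + i, c, N + i + 1)) ++
    [(u, 0, N), (N + n, v, N + n + 1)])))

theorem prim_triples (N : ℕ) (R : List (ℕ × ℕ × ℕ)) (u c v : ℕ) :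
    Primrec (triples N R u c v) := by
  have hid : Primrec (fun n : ℕ => n) := Primrec.id
  have hNn : Primrec (fun n : ℕ => N + n) := Primrec.nat_add.comp (Primrec.const N) hid
  have hg : Primrec (fun n : ℕ => N + n + 2) := Primrec.nat_add.comp hNn (Primrec.const 2)
  have hr := Primrec.list_range.comp hg
  have hNi : Primrec (fun x : ℕ × ℕ => N + x.2) := hNn.comp Primrec.snd
  unfold triples
  refine Primrec.list_append.comp (Primrec.const R) (Primrec.list_append.comp ?_
    (Primrec.list_append.comp ?_ (Primrec.list_append.comp ?_ ?_)))
  · exact Primrec.list_map hr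
      ((Primrec.const 0).pair (Primrec.snd.pair Primrec.snd)).to₂
  · exact Primrec.list_map hr
      (Primrec.snd.pair ((Primrec.const 0).pair Primrec.snd)).to₂
  · exact Primrec.list_map (Primrec.list_range.comp hid)
      (hNi.pair ((Primrec.const c).pair (Primrec.succ.comp hNi))).to₂
  · exact prim_l2 (Primrec.const (u, 0, N))
      (hNn.pair ((Primrec.const v).pair (Primrec.succ.comp hNn)))

theorem mem_triples {N : ℕ} {R : List (ℕ × ℕ × ℕ)} {u c v n : ℕ} {x : ℕ × ℕ × ℕ} :
    x ∈ triples N R u c v n ↔ x ∈ R ∨ (∃ a < N + n + 2, x = (0, a, a)) ∨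
      (∃ a < N + n + 2, x = (a, 0, a)) ∨ (∃ i < n, x = (N + i, c, N + i + 1)) ∨
      x = (u, 0, N) ∨ x = (N + n, v, N + n + 1) := by
  unfold triples
  simp only [List.mem_append, List.mem_map, List.mem_range, List.mem_cons, List.not_mem_nil,
    or_false, eq_comm (a := x)]

theorem exists_inst : ∃ inst : ℕ → EntInstance, Computable inst ∧ (∀ n, EntValid (inst n)) ∧
    ∀ n b₁ b₂, (0 ∈ diagU n → EntHolds b₁ b₂ (inst n)) ∧
      (1 ∈ diagU n → ¬ EntHolds b₁ b₂ (inst n)) := by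
  obtain ⟨N, R, u, c, v, t, hN, hu, hc, hv, ht, hR, hmain⟩ := core_theorem
  let g : ℕ → ℕ := fun n => N + n + 2
  let k : ℕ → ℕ := fun n => 3 + 3 * g n
  let T : ℕ → List (ℕ × ℕ × ℕ) := triples N R u c v
  have pg : Primrec g := Primrec.nat_add.comp (Primrec.nat_add.comp (Primrec.const N) Primrec.id)
    (Primrec.const 2)
  have pk : Primrec k := Primrec.nat_add.comp (Primrec.const 3)
    (Primrec.nat_mul.comp (Primrec.const 3) pg)
  have ps : Primrec (fun n => N + n + 1) :=
    Primrec.succ.comp (Primrec.nat_add.comp (Primrec.const N) Primrec.id)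
  have hg : ∀ n, 0 < g n := fun n => by simp [g]
  have hTlt : ∀ n, ∀ x ∈ T n, x.1 < g n ∧ x.2.1 < g n ∧ x.2.2 < g n := by
    intro n x hx
    rcases mem_triples.1 hx with h | ⟨a, ha, rfl⟩ | ⟨a, ha, rfl⟩ | ⟨i, hi, rfl⟩ | rfl | rfl
    · have := hR x h
      simp only [g]; omega
    all_goals simp only [g]; omega
  have hok : ∀ n, ∀ c ∈ allCons (g n) (T n), OKc (k n) c := fun n =>
    ok_allCons (g n) (hg n) _ (hTlt n)
  have hok2 : ∀ n, OKc (k n) (concl (N + n + 1) t) := fun n =>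
    ok_concl (g n) _ _ (by simp [g]) (by simp only [g]; omega) (by omega)
  refine ⟨fun n => (k n, coef (k n) (allCons (g n) (T n)), coef (k n) [concl (N + n + 1) t]),
    ?_, ?_, ?_⟩
  · refine (Primrec.pair pk (Primrec.pair ?_ ?_)).to_comp
    · exact prim_coef pk (prim_allCons pg (prim_triples N R u c v))
    · exact prim_coef pk (prim_l1 (prim_con _ (prim_l1 (prim_qp ps 2)) (Primrec.const _)))
  · intro n
    refine ⟨by simp only [k]; omega, ?_, ?_⟩ <;> simp [coef]
  · intro n b₁ b₂
    obtain ⟨m0, m1⟩ := hmain n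
    constructor
    · intro h0
      refine red_sound (k n) _ _ (hok n) (hok2 n) rfl ?_ b₁ b₂
      intro Ω W x _ hs
      refine comb_sound (g n) (hg n) (T n) _ _ (by simp [g]) (by simp only [g]; omega) (hTlt n)
        ?_ ?_ W x hs
      · intro a ha
        exact ⟨mem_triples.2 (Or.inr (Or.inl ⟨a, ha, rfl⟩)),
          mem_triples.2 (Or.inr (Or.inr (Or.inl ⟨a, ha, rfl⟩)))⟩
      · intro P F hF
        have hR' : IsModel R F := ⟨hF.1, fun x hx => hF.2 x (mem_triples.2 (Or.inl hx))⟩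
        rw [← m0 h0 P F hR']
        have e0 : F N = F u := by
          have := hF.2 (u, 0, N)
            (mem_triples.2 (Or.inr (Or.inr (Or.inr (Or.inr (Or.inl rfl))))))
          simpa [hF.1] using this
        have ei : ∀ i ≤ n, F (N + i) = (F c)^[i] ∘ F u := by
          intro i
          induction i with
          | zero => intro _; simpa using e0
          | succ i ih =>
            intro hi
            have := hF.2 (N + i, c, N + i + 1)
              (mem_triples.2 (Or.inr (Or.inr (Or.inr (Or.inl ⟨i, by omega, rfl⟩)))))
            dsimp only at this
            rw [← add_assoc, this, ih (by omega), Function.iterate_succ', Function.comp_assoc]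
        have := hF.2 (N + n, v, N + n + 1)
          (mem_triples.2 (Or.inr (Or.inr (Or.inr (Or.inr (Or.inr rfl))))))
        dsimp only at this
        rw [this, ei n le_rfl]
    · intro h1
      obtain ⟨P, hP, F, hF, hne⟩ := m1 h1
      let F' : ℕ → P → P := fun a => if a < N then F a else if a ≤ N + n then
        (F c)^[a - N] ∘ F u else F v ∘ (F c)^[n] ∘ F u
      have f1 : ∀ a < N, F' a = F a := fun a ha => by simp [F', ha]
      have f2 : ∀ i ≤ n, F' (N + i) = (F c)^[i] ∘ F u := fun i hi => by simp [F', hi]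
      have f3 : F' (N + n + 1) = F v ∘ (F c)^[n] ∘ F u := by
        have e1 : ¬ N + n + 1 < N := by omega
        have e2 : ¬ N + n + 1 ≤ N + n := by omega
        simp only [F', e1, e2, if_false]
      have f0 : F' 0 = id := by rw [f1 0 hN, hF.1]
      have hF' : IsModel (T n) F' := by
        refine ⟨f0, fun x hx => ?_⟩
        rcases mem_triples.1 hx with h | ⟨a, ha, rfl⟩ | ⟨a, ha, rfl⟩ | ⟨i, hi, rfl⟩ | rfl | rfl
        · obtain ⟨r1, r2, r3⟩ := hR x h
          rw [f1 _ r1, f1 _ r2, f1 _ r3]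
          exact hF.2 x h
        · simp [f0]
        · simp [f0]
        · dsimp only
          rw [add_assoc, f2 (i + 1) (by omega), f2 i (by omega), f1 c hc, Function.iterate_succ',
            Function.comp_assoc]
        · dsimp only
          have := f2 0 (by omega)
          simp only [add_zero, Function.iterate_zero, Function.id_comp] at this
          rw [f0, this, f1 u hu]
          rfl
        · dsimp only
          rw [f3, f1 v hv, f2 n le_rfl]
      have hne' : F' (N + n + 1) ≠ F' t := by rw [f3, f1 t ht]; exact hne
      obtain ⟨c1, c2⟩ := comb_complete (g n) (T n) _ _ F' hF' hne'
      have : Finite (VV P) := Finite.of_injective (fun f : VV P => (f : P → ZMod 2))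
        DFunLike.coe_injective
      have : Fintype (VV P × VV P × VV P) := Fintype.ofFinite _
      exact red_complete _ (k n) _ _ (hok n) (hok2 n) c1 c2 b₁ b₂

theorem main_result : ∀ b₁ b₂ : Bool,
      ¬ ∃ f : EntInstance → Bool, Computable f ∧
        ∀ inst : EntInstance, EntValid inst → (f inst = true ↔ EntHolds b₁ b₂ inst) := by
  rintro b₁ b₂ ⟨f, hf, hspec⟩
  obtain ⟨inst, hc, hval, h⟩ := exists_inst
  refine diagU_inseparable (fun n => f (inst n)) (hf.comp hc) ?_ ?_
  · intro n hn
    exact (hspec _ (hval n)).2 ((h n b₁ b₂).1 hn)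
  · intro n hn
    by_contra hcon
    exact (h n b₁ b₂).2 hn ((hspec _ (hval n)).1 (by simpa using hcon))

end UndecCII
end

/-- Corollary `entropy`: the conditional information inequality problem
is undecidable, and it remains undecidable if either one or both of the two relations
`≥ 0` are replaced by `= 0` (the four combinations are selected by `b₁, b₂ : Bool`). -/
theorem undecidable_cond_info_ineq :
    ∀ b₁ b₂ : Bool,
      ¬ ∃ f : EntInstance → Bool, Computable f ∧
        ∀ inst : EntInstance, EntValid inst → (f inst = true ↔ EntHolds b₁ b₂ inst) := by
  exact UndecCII.main_result

end
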